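/- Let β be a positive integer. There exist constants C > 0 and x₀ ≥ 3 such that for all reals x ≥ x₀ and y ≥ x^{β} one has |C_{1,β}(x,y) − y + x^{1+β}/(2(1+β)ζ(1+β))| ≤ C · R(x,y), where R(x,y) = x·y^{1/3}·log x + x³·y^{−1} if β = 1, and R(x,y) = x^{(1+2β)/3}·y^{1/3} + x^{1+2β}·y^{−1} if β > 1. -/

import Mathlib

open Complex Finset
open scoped Classical

/-- The generalized Ramanujan sum of Cohen: `c_{q,β}(n) = Σ_h exp(2πinh/q^β)` where `h`
runs over `0 ≤ h < q^β` such that `h` and `q^β` have no common `β`-th power divisor `> 1`. -/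
noncomputable def cohenRamanujan (β q n : ℕ) : ℂ :=
  ∑ h ∈ (Finset.range (q ^ β)).filter
      (fun h => ∀ d : ℕ, 1 < d → ¬(d ^ β ∣ h ∧ d ^ β ∣ q ^ β)),
    Complex.exp (2 * Real.pi * Complex.I * n * h / (q ^ β))

/-- The `k`-th moment of averages `C_{k,β}(x,y) = Σ_{n ≤ y} (Σ_{q ≤ x} c_{q,β}(n))^k`. -/
noncomputable def momentC (k β : ℕ) (x y : ℝ) : ℂ :=
  ∑ n ∈ Finset.Icc 1 ⌊y⌋₊, (∑ q ∈ Finset.Icc 1 ⌊x⌋₊, cohenRamanujan β q n) ^ k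

/-- The additive character `t ↦ exp(2πit)` on the real line. -/
noncomputable def expCircle (t : ℝ) : ℂ := Complex.exp ((2 * Real.pi * t : ℝ) * Complex.I)

lemma norm_expCircle (t : ℝ) : ‖expCircle t‖ = 1 := Complex.norm_exp_ofReal_mul_I _

lemma expCircle_add (s t : ℝ) : expCircle (s + t) = expCircle s * expCircle t := by
  unfold expCircle
  rw [← Complex.exp_add]
  push_cast
  ring_nf

lemma expCircle_intCast (k : ℤ) : expCircle k = 1 := by
  unfold expCircle
  rw [Complex.exp_eq_one_iff]
  exact ⟨k, by push_cast; ring⟩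

lemma expCircle_re (t : ℝ) : (expCircle t).re = Real.cos (2 * Real.pi * t) := by
  unfold expCircle
  rw [Complex.exp_ofReal_mul_I_re]

/-- Closed form of `1 / (1 - exp(2πit))`. -/
lemma cot_mul_one_sub_expCircle {t : ℝ} (ht : Real.sin (Real.pi * t) ≠ 0) :
    ((1 / 2 : ℂ) + (Real.cos (Real.pi * t) / (2 * Real.sin (Real.pi * t)) : ℝ) * Complex.I) *
      (1 - expCircle t) = 1 := by
  have h : expCircle t = (Real.cos (Real.pi * t) + Real.sin (Real.pi * t) * Complex.I) ^ 2 := by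
    unfold expCircle
    rw [Complex.ofReal_cos, Complex.ofReal_sin, ← Complex.exp_mul_I, ← Complex.exp_nat_mul]
    push_cast
    ring_nf
  rw [h]
  have h1 : (Real.cos (Real.pi * t) : ℂ) ^ 2 + (Real.sin (Real.pi * t) : ℂ) ^ 2 = 1 := by
    exact_mod_cast Real.cos_sq_add_sin_sq _
  have h2 : (Real.sin (Real.pi * t) : ℂ) ≠ 0 := by exact_mod_cast ht
  push_cast [Complex.ofReal_cos, Complex.ofReal_sin] at h1 h2 ⊢
  generalize Complex.cos (Real.pi * t) = c at *
  generalize Complex.sin (Real.pi * t) = s at *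
  field_simp
  ring_nf
  simp only [Complex.I_sq, Complex.I_pow_three]
  linear_combination (s - c * Complex.I) * h1

lemma two_mul_le_sin_pi_mul {θ t : ℝ} (hθ : 0 ≤ θ) (h1 : θ ≤ t) (h2 : t ≤ 1 - θ) :
    2 * θ ≤ Real.sin (Real.pi * t) := by
  have hpi := Real.pi_pos
  rcases le_total t (1 / 2) with h | h
  · have := Real.mul_le_sin (x := Real.pi * t) (by nlinarith) (by nlinarith)
    have h3 : 2 / Real.pi * (Real.pi * t) = 2 * t := by field_simp
    linarith
  · have := Real.mul_le_sin (x := Real.pi * (1 - t)) (by nlinarith) (by nlinarith)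
    have h3 : 2 / Real.pi * (Real.pi * (1 - t)) = 2 * (1 - t) := by field_simp
    have h4 : Real.sin (Real.pi * (1 - t)) = Real.sin (Real.pi * t) := by
      rw [mul_sub, mul_one, Real.sin_pi_sub]
    linarith

/-- The Kusmin–Landau inequality for sequences with monotone increments. -/
theorem norm_sum_expCircle_le_of_increments (u : ℕ → ℝ) (a b : ℕ) (k : ℤ) {θ : ℝ} (hθ : 0 < θ)
    (hmono : ∀ n, a ≤ n → n + 1 < b → u (n + 1) - u n ≤ u (n + 2) - u (n + 1))
    (hlo : ∀ n ∈ Ico a b, k + θ ≤ u (n + 1) - u n)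
    (hhi : ∀ n ∈ Ico a b, u (n + 1) - u n ≤ k + 1 - θ) :
    ‖∑ n ∈ Ico a b, expCircle (u n)‖ ≤ 1 / θ := by
  set γ : ℕ → ℝ := fun n => u (n + 1) - u n - k with hγ
  set r : ℕ → ℝ := fun n => Real.cos (Real.pi * γ n) / (2 * Real.sin (Real.pi * γ n)) with hr
  have hsin : ∀ n ∈ Ico a b, 2 * θ ≤ Real.sin (Real.pi * γ n) := fun n hn =>
    two_mul_le_sin_pi_mul hθ.le (by have := hlo n hn; simp only [hγ]; linarith)
      (by have := hhi n hn; simp only [hγ]; linarith)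
  have hstep : ∀ n ∈ Ico a b, expCircle (u n) =
      ((1 / 2 : ℂ) + (r n : ℝ) * Complex.I) * (expCircle (u n) - expCircle (u (n + 1))) := by
    intro n hn
    have h1 : expCircle (u (n + 1)) = expCircle (u n) * expCircle (γ n) := by
      have : u (n + 1) = u n + (γ n + (k : ℤ)) := by simp only [hγ]; ring
      rw [this, expCircle_add, expCircle_add, expCircle_intCast, mul_one]
    have h2 := cot_mul_one_sub_expCircle (t := γ n) (by have := hsin n hn; linarith)
    rw [h1]
    linear_combination (-expCircle (u n)) * h2
  have hrb : ∀ n ∈ Ico a b, |r n| ≤ 1 / (4 * θ) := by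
    intro n hn
    have h1 := hsin n hn
    simp only [hr]
    rw [abs_div, abs_of_pos (by linarith : 0 < 2 * Real.sin (Real.pi * γ n))]
    exact div_le_div₀ zero_le_one (Real.abs_cos_le_one _) (by linarith) (by linarith)
  have hθ' : 2 * θ ≤ 1 ∨ b ≤ a := by
    by_contra! h
    have := (hsin a (mem_Ico.2 ⟨le_rfl, h.2⟩)).trans (Real.sin_le_one _)
    linarith [h.1]
  rcases hθ' with hθ' | hab
  swap
  · rw [Finset.Ico_eq_empty (by omega)]; simp; exact hθ.le
  have hcb : ∀ n ∈ Ico a b, ‖((1 / 2 : ℂ) + (r n : ℝ) * Complex.I)‖ ≤ 1 / (4 * θ) := by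
    intro n hn
    have h1 := hsin n hn
    have h2 : ‖((1 / 2 : ℂ) + (r n : ℝ) * Complex.I)‖ ^ 2 ≤ (1 / (4 * θ)) ^ 2 := by
      have h5 : ∀ x : ℝ, ‖((1 / 2 : ℂ) + (x : ℝ) * Complex.I)‖ ^ 2 = 1 / 4 + x ^ 2 := by
        intro x
        rw [Complex.sq_norm, Complex.normSq_apply]
        simp
        ring
      rw [h5]
      simp only [hr]
      have h3 := Real.cos_sq_add_sin_sq (Real.pi * γ n)
      have h4 : Real.sin (Real.pi * γ n) ≠ 0 := by linarith
      calc _ = 1 / (2 * Real.sin (Real.pi * γ n)) ^ 2 := by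
            field_simp
            linarith
        _ ≤ 1 / (4 * θ) ^ 2 := by
            apply one_div_le_one_div_of_le (by positivity)
            apply pow_le_pow_left₀ (by positivity)
            linarith
        _ = _ := by field_simp
    exact le_of_sq_le_sq h2 (by positivity)
  have hra : ∀ n, a ≤ n → n + 1 < b → r (n + 1) ≤ r n := by
    intro n hn1 hn2
    have m1 : n ∈ Ico a b := mem_Ico.2 ⟨hn1, by omega⟩
    have m2 : n + 1 ∈ Ico a b := mem_Ico.2 ⟨by omega, by omega⟩
    have s1 := hsin _ m1
    have s2 := hsin _ m2
    have hd : 0 ≤ Real.sin (Real.pi * γ (n + 1) - Real.pi * γ n) := by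
      rw [← mul_sub]
      have hγn : γ n ≤ γ (n + 1) := by
        have := hmono n hn1 hn2; simp only [hγ]; linarith
      have hγd : γ (n + 1) - γ n ≤ 1 := by
        have := hhi _ m2
        have := hlo _ m1
        simp only [hγ]; linarith
      exact Real.sin_nonneg_of_nonneg_of_le_pi
        (mul_nonneg Real.pi_pos.le (by linarith)) (by nlinarith [Real.pi_pos])
    rw [Real.sin_sub] at hd
    simp only [hr]
    rw [div_le_div_iff₀ (by linarith) (by linarith)]
    nlinarith
  have key : ∀ m, a ≤ m → m < b →
      ‖(∑ n ∈ Ico a (m + 1), expCircle (u n)) +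
        ((1 / 2 : ℂ) + (r m : ℝ) * Complex.I) * expCircle (u (m + 1))‖ ≤
        1 / (4 * θ) + (r a - r m) := by
    intro m ham
    induction m, ham using Nat.le_induction with
    | base =>
      intro hb
      rw [Finset.sum_Ico_succ_top le_rfl, Finset.Ico_self, Finset.sum_empty, zero_add,
        hstep a (mem_Ico.2 ⟨le_rfl, hb⟩)]
      have := hcb a (mem_Ico.2 ⟨le_rfl, hb⟩)
      rw [mul_sub, sub_add_cancel, norm_mul, norm_expCircle]
      linarith
    | succ m ham ih =>
      intro hb
      have ih := ih (by omega)
      rw [Finset.sum_Ico_succ_top (by omega)]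
      have h1 := hstep (m + 1) (mem_Ico.2 ⟨by omega, hb⟩)
      have h2 : (∑ n ∈ Ico a (m + 1), expCircle (u n)) + expCircle (u (m + 1)) +
          ((1 / 2 : ℂ) + (r (m + 1) : ℝ) * Complex.I) * expCircle (u (m + 1 + 1)) =
          ((∑ n ∈ Ico a (m + 1), expCircle (u n)) +
            ((1 / 2 : ℂ) + (r m : ℝ) * Complex.I) * expCircle (u (m + 1))) +
          ((r (m + 1) - r m : ℝ) : ℂ) * Complex.I * expCircle (u (m + 1)) := by
        push_cast
        linear_combination h1
      rw [h2]
      refine (norm_add_le _ _).trans ?_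
      have h3 := hra m ham hb
      rw [norm_mul, norm_mul, norm_expCircle, Complex.norm_I, Complex.norm_real, mul_one, mul_one,
        Real.norm_eq_abs, abs_of_nonpos (by linarith)]
      linarith
  rcases le_or_gt b a with hab | hab
  · rw [Finset.Ico_eq_empty (by omega)]; simp; exact hθ.le
  obtain ⟨m, rfl⟩ : ∃ m, b = m + 1 := ⟨b - 1, by omega⟩
  have hm : m ∈ Ico a (m + 1) := mem_Ico.2 ⟨by omega, by omega⟩
  have h1 := key m (by omega) (by omega)
  have h2 := hcb m hm
  have h3 := abs_le.1 (hrb m hm)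
  have h4 := abs_le.1 (hrb a (mem_Ico.2 ⟨le_rfl, hab⟩))
  have h5 := norm_sub_le ((∑ n ∈ Ico a (m + 1), expCircle (u n)) +
        ((1 / 2 : ℂ) + (r m : ℝ) * Complex.I) * expCircle (u (m + 1)))
        (((1 / 2 : ℂ) + (r m : ℝ) * Complex.I) * expCircle (u (m + 1)))
  rw [add_sub_cancel_right, norm_mul, norm_expCircle, mul_one] at h5
  have h6 : 1 / θ = 4 * (1 / (4 * θ)) := by field_simp
  linarith

lemma Finset.exists_eq_Ico_of_ordConnected (s : Finset ℕ)
    (hs : ∀ x ∈ s, ∀ z ∈ s, ∀ y, x ≤ y → y ≤ z → y ∈ s) : ∃ c d, s = Finset.Ico c d := by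
  rcases s.eq_empty_or_nonempty with rfl | hne
  · exact ⟨0, 0, by simp⟩
  · refine ⟨s.min' hne, s.max' hne + 1, ?_⟩
    ext y
    rw [Finset.mem_Ico]
    constructor
    · intro hy
      have := s.min'_le y hy
      have := s.le_max' y hy
      omega
    · rintro ⟨h1, h2⟩
      exact hs _ (s.min'_mem hne) _ (s.max'_mem hne) y h1 (by omega)

lemma add_mul_sub_le_of_step {δ : ℕ → ℝ} {a b : ℕ} {l : ℝ}
    (hsec : ∀ n, a ≤ n → n + 1 < b → δ n + l ≤ δ (n + 1)) {n m : ℕ} (han : a ≤ n) (hnm : n ≤ m)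
    (hmb : m < b) : δ n + l * ((m : ℝ) - n) ≤ δ m := by
  induction m, hnm using Nat.le_induction with
  | base => simp
  | succ m hnm ih =>
    have h1 := ih (by omega)
    have h2 := hsec m (by omega) hmb
    push_cast
    linarith

lemma card_le_of_step {δ : ℕ → ℝ} {a b : ℕ} {l : ℝ} (hl : 0 < l)
    (hsec : ∀ n, a ≤ n → n + 1 < b → δ n + l ≤ δ (n + 1)) {t : Finset ℕ} (ht : t ⊆ Finset.Ico a b)
    {p θ : ℝ} (hθ : 0 ≤ θ) (hp : ∀ n ∈ t, p ≤ δ n) (hq : ∀ n ∈ t, δ n ≤ p + θ) :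
    (t.card : ℝ) ≤ θ / l + 1 := by
  rcases t.eq_empty_or_nonempty with rfl | hne
  · simp; positivity
  · have h1 := t.min'_mem hne
    have h2 := t.max'_mem hne
    have hsub : t ⊆ Finset.Icc (t.min' hne) (t.max' hne) := fun y hy =>
      Finset.mem_Icc.2 ⟨t.min'_le y hy, t.le_max' y hy⟩
    have hmm := t.min'_le_max' hne
    have h3 := Finset.card_le_card hsub
    rw [Nat.card_Icc] at h3
    have h4 : (t.card : ℝ) ≤ (t.max' hne : ℝ) + 1 - t.min' hne := by
      have : t.card + t.min' hne ≤ t.max' hne + 1 := by omega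
      have : (t.card : ℝ) + t.min' hne ≤ t.max' hne + 1 := by exact_mod_cast this
      linarith
    have h5 := add_mul_sub_le_of_step hsec (Finset.mem_Ico.1 (ht h1)).1 hmm
      (Finset.mem_Ico.1 (ht h2)).2
    have h6 := hp _ h1
    have h7 := hq _ h2
    have h8 : ((t.max' hne : ℝ) - t.min' hne) ≤ θ / l := by
      rw [le_div_iff₀ hl]; linarith
    linarith

/-- Van der Corput's second derivative test for sequences, with a free parameter `θ`. -/
theorem norm_sum_expCircle_le_of_second_difference (u : ℕ → ℝ) (a b : ℕ) {A B l θ : ℝ}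
    (hAB : A ≤ B) (hl : 0 < l) (hθ : 0 < θ)
    (hA : ∀ n ∈ Ico a b, A ≤ u (n + 1) - u n) (hB : ∀ n ∈ Ico a b, u (n + 1) - u n ≤ B)
    (hsec : ∀ n, a ≤ n → n + 1 < b → u (n + 1) - u n + l ≤ u (n + 2) - u (n + 1)) :
    ‖∑ n ∈ Ico a b, expCircle (u n)‖ ≤ (B - A + 2) * (1 / θ + 2 * (θ / l + 1)) := by
  set δ : ℕ → ℝ := fun n => u (n + 1) - u n with hδ
  have hsec' : ∀ n, a ≤ n → n + 1 < b → δ n + l ≤ δ (n + 1) := hsec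
  have hmon : ∀ n m, a ≤ n → n ≤ m → m < b → δ n ≤ δ m := fun n m h1 h2 h3 => by
    have := add_mul_sub_le_of_step hsec' h1 h2 h3
    have h4 : (n : ℝ) ≤ m := by exact_mod_cast h2
    nlinarith
  have hmaps : ∀ n ∈ Ico a b, ⌊δ n⌋ ∈ Finset.Icc ⌊A⌋ ⌊B⌋ := fun n hn =>
    Finset.mem_Icc.2 ⟨Int.floor_le_floor (hA n hn), Int.floor_le_floor (hB n hn)⟩
  rw [← Finset.sum_fiberwise_of_maps_to hmaps]
  have hfib : ∀ k ∈ Finset.Icc ⌊A⌋ ⌊B⌋,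
      ‖∑ n ∈ (Ico a b).filter (fun n => ⌊δ n⌋ = k), expCircle (u n)‖ ≤
        1 / θ + 2 * (θ / l + 1) := by
    intro k _
    have hcard : ∀ t : Finset ℕ, ‖∑ n ∈ t, expCircle (u n)‖ ≤ t.card := fun t => by
      refine (norm_sum_le _ _).trans ?_
      simp [norm_expCircle]
    rw [← Finset.sum_filter_add_sum_filter_not _ (fun n => k + θ ≤ δ n)]
    rw [← Finset.sum_filter_add_sum_filter_not
      (Finset.filter (fun n => k + θ ≤ δ n) _) (fun n => δ n ≤ k + 1 - θ)]
    have e1 : ‖∑ n ∈ ((((Ico a b).filter (fun n => ⌊δ n⌋ = k)).filter (fun n => k + θ ≤ δ n)).filter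
        (fun n => δ n ≤ k + 1 - θ)), expCircle (u n)‖ ≤ 1 / θ := by
      obtain ⟨c, d, hcd⟩ := Finset.exists_eq_Ico_of_ordConnected
        ((((Ico a b).filter (fun n => ⌊δ n⌋ = k)).filter (fun n => k + θ ≤ δ n)).filter
        (fun n => δ n ≤ k + 1 - θ)) (by
          intro x hx z hz y hxy hyz
          simp only [Finset.mem_filter, Finset.mem_Ico] at hx hz ⊢
          have h1 := hmon x y (by omega) hxy (by omega)
          have h2 := hmon y z (by omega) hyz (by omega)
          refine ⟨⟨⟨⟨by omega, by omega⟩, ?_⟩, by linarith⟩, by linarith⟩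
          rw [Int.floor_eq_iff]
          constructor <;> linarith)
      have hmem : ∀ n, n ∈ Ico c d ↔ _ := fun n => by rw [← hcd]
      simp only [Finset.mem_filter] at hmem
      rw [hcd]
      apply norm_sum_expCircle_le_of_increments u c d k hθ
      · intro n h1 h2
        have m1 := (hmem n).1 (Finset.mem_Ico.2 ⟨h1, by omega⟩)
        have m2 := (hmem (n + 1)).1 (Finset.mem_Ico.2 ⟨by omega, by omega⟩)
        have m3 := Finset.mem_Ico.1 m1.1.1.1
        have m4 := Finset.mem_Ico.1 m2.1.1.1
        exact hmon n (n + 1) m3.1 (by omega) m4.2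
      · exact fun n hn => ((hmem n).1 hn).1.2
      · exact fun n hn => ((hmem n).1 hn).2
    have e2 : ‖∑ n ∈ ((((Ico a b).filter (fun n => ⌊δ n⌋ = k)).filter (fun n => k + θ ≤ δ n)).filter
        (fun n => ¬ δ n ≤ k + 1 - θ)), expCircle (u n)‖ ≤ θ / l + 1 := by
      refine (hcard _).trans (card_le_of_step hl hsec' (p := k + 1 - θ) ?_ hθ.le ?_ ?_)
      · exact ((Finset.filter_subset _ _).trans (Finset.filter_subset _ _)).trans
          (Finset.filter_subset _ _)
      · intro n hn
        simp only [Finset.mem_filter] at hn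
        exact (not_le.1 hn.2).le
      · intro n hn
        simp only [Finset.mem_filter] at hn
        have h1 := Int.lt_floor_add_one (δ n)
        rw [hn.1.1.2] at h1
        linarith
    have e3 : ‖∑ n ∈ (((Ico a b).filter (fun n => ⌊δ n⌋ = k)).filter (fun n => ¬ k + θ ≤ δ n)),
        expCircle (u n)‖ ≤ θ / l + 1 := by
      refine (hcard _).trans (card_le_of_step hl hsec' (p := k) ?_ hθ.le ?_ ?_)
      · exact (Finset.filter_subset _ _).trans (Finset.filter_subset _ _)
      · intro n hn
        simp only [Finset.mem_filter] at hn
        have h1 := Int.floor_le (δ n)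
        rwa [hn.1.2] at h1
      · intro n hn
        simp only [Finset.mem_filter] at hn
        exact (not_le.1 hn.2).le
    refine (norm_add_le _ _).trans ?_
    have := norm_add_le (∑ n ∈ ((((Ico a b).filter (fun n => ⌊δ n⌋ = k)).filter
        (fun n => k + θ ≤ δ n)).filter (fun n => δ n ≤ k + 1 - θ)), expCircle (u n))
        (∑ n ∈ ((((Ico a b).filter (fun n => ⌊δ n⌋ = k)).filter (fun n => k + θ ≤ δ n)).filter
        (fun n => ¬ δ n ≤ k + 1 - θ)), expCircle (u n))
    linarith
  refine (norm_sum_le_of_le _ hfib).trans ?_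
  rw [Finset.sum_const, nsmul_eq_mul]
  apply mul_le_mul_of_nonneg_right _ (by positivity)
  rw [Int.card_Icc]
  have h1 : ⌊A⌋ ≤ ⌊B⌋ := Int.floor_le_floor hAB
  have h2 : (((⌊B⌋ + 1 - ⌊A⌋).toNat : ℤ) : ℝ) = (⌊B⌋ + 1 - ⌊A⌋ : ℤ) := by
    rw [Int.toNat_of_nonneg (by omega)]
  rw [Int.cast_natCast] at h2
  rw [h2]
  push_cast
  have := Int.floor_le B
  have := Int.lt_floor_add_one A
  linarith

lemma hasDerivAt_inv_pow_succ (k : ℕ) {t : ℝ} (ht : 0 < t) :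
    HasDerivAt (fun s : ℝ => (s ^ k)⁻¹) (-(k / t ^ (k + 1))) t := by
  have h := (hasDerivAt_pow k t).inv (pow_ne_zero k ht.ne')
  refine h.congr_deriv ?_
  rcases k with _ | k
  · simp
  · simp only [Nat.add_sub_cancel]
    field_simp
    ring

lemma inv_pow_sub_inv_pow_mem (k : ℕ) {t : ℝ} (ht : 0 < t) :
    k / (t + 1) ^ (k + 1) ≤ (t ^ k)⁻¹ - ((t + 1) ^ k)⁻¹ ∧
      (t ^ k)⁻¹ - ((t + 1) ^ k)⁻¹ ≤ k / t ^ (k + 1) := by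
  obtain ⟨c, ⟨hc1, hc2⟩, hc⟩ := exists_hasDerivAt_eq_slope (fun s : ℝ => (s ^ k)⁻¹)
    (fun s => -(k / s ^ (k + 1))) (by linarith : t < t + 1)
    (fun s hs => (hasDerivAt_inv_pow_succ k
      (by linarith [hs.1] : 0 < s)).continuousAt.continuousWithinAt)
    (fun s hs => hasDerivAt_inv_pow_succ k (by linarith [hs.1] : 0 < s))
  have h1 : (t ^ k)⁻¹ - ((t + 1) ^ k)⁻¹ = k / c ^ (k + 1) := by
    rw [add_sub_cancel_left, div_one] at hc
    linarith
  have hc0 : 0 < c := by linarith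
  rw [h1]
  constructor
  · gcongr
  · gcongr

lemma le_second_difference_inv_pow (k : ℕ) {t : ℝ} (ht : 0 < t) :
    k * (k + 1) / (t + 2) ^ (k + 2) ≤
      (((t + 2) ^ k)⁻¹ - ((t + 1) ^ k)⁻¹) - (((t + 1) ^ k)⁻¹ - (t ^ k)⁻¹) := by
  have hd : ∀ s : ℝ, 0 < s → HasDerivAt (fun s : ℝ => ((s + 1) ^ k)⁻¹ - (s ^ k)⁻¹)
      (-(k / (s + 1) ^ (k + 1)) - -(k / s ^ (k + 1))) s := fun s hs =>
    (HasDerivAt.comp_add_const s 1 (hasDerivAt_inv_pow_succ k (by linarith))).sub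
      (hasDerivAt_inv_pow_succ k hs)
  obtain ⟨c, ⟨hc1, hc2⟩, hc⟩ := exists_hasDerivAt_eq_slope _ _ (by linarith : t < t + 1)
    (fun s hs => (hd s (by linarith [hs.1])).continuousAt.continuousWithinAt)
    (fun s hs => hd s (by linarith [hs.1]))
  have hc0 : 0 < c := by linarith
  have h1 := (inv_pow_sub_inv_pow_mem (k + 1) hc0).1
  have h2 : (k * (k + 1) : ℝ) / (t + 2) ^ (k + 2) ≤ k * ((k + 1) / (c + 1) ^ (k + 2)) := by
    rw [mul_div_assoc]
    refine mul_le_mul_of_nonneg_left ?_ (by positivity)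
    exact div_le_div_of_nonneg_left (by positivity) (by positivity)
      (pow_le_pow_left₀ (by positivity) (by linarith) _)
  have h3 : (k : ℝ) * ((k + 1) / (c + 1) ^ (k + 2)) ≤
      k * ((c ^ (k + 1))⁻¹ - ((c + 1) ^ (k + 1))⁻¹) := by
    push_cast at h1
    gcongr
  refine h2.trans (h3.trans (le_of_eq ?_))
  have e : t + 1 + 1 = t + 2 := by ring
  rw [add_sub_cancel_left, div_one, e] at hc
  rw [← hc]
  ring

/-- Exponential sums of `w / n ^ β` over a subinterval of a dyadic block, where `F` is the size
of the derivative. -/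
theorem exists_norm_sum_expCircle_div_pow_le (β : ℕ) (hβ : 0 < β) :
    ∃ C > 0, ∀ (m N : ℕ) (w F : ℝ), N ≤ 2 * m + 1 → 0 < N → 0 < w → F = w / N ^ (β + 1) →
      ‖∑ n ∈ Ico (m + 1) (N + 1), expCircle (w / n ^ β)‖ ≤ C * (√(F * N) + 1 / F) := by
  have hβ1 : (1 : ℝ) ≤ β := by exact_mod_cast hβ
  set c1 : ℝ := β * 2 ^ (β + 1) with hc1
  set c0 : ℝ := β / 2 ^ (β + 1) with hc0
  set c2 : ℝ := β * (β + 1) / 3 ^ (β + 2) with hc2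
  have p0 : 0 < c0 := by positivity
  have p1 : 0 < c1 := by positivity
  have p2 : 0 < c2 := by positivity
  have h01 : c0 ≤ c1 := by
    have h2 : (1 : ℝ) ≤ 2 ^ (β + 1) := one_le_pow₀ (by norm_num)
    calc c0 ≤ β := div_le_self (by positivity) h2
      _ ≤ c1 := le_mul_of_one_le_right (by positivity) h2
  refine ⟨1 / c0 + 25 * c1 / √c2 + √c2, by positivity, ?_⟩
  intro m N w F hmN hN hw hF
  have hN' : (0 : ℝ) < N := by exact_mod_cast hN
  have hFpos : 0 < F := by rw [hF]; positivity
  have bnd : ∀ n ∈ Ico (m + 1) (N + 1), (N : ℝ) / 2 ≤ n ∧ (n : ℝ) + 1 ≤ 2 * N ∧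
      (n : ℝ) + 2 ≤ 3 * N ∧ 0 < (n : ℝ) := by
    intro n hn
    rw [mem_Ico] at hn
    have h1 : (N : ℝ) ≤ 2 * n := by exact_mod_cast (by omega : N ≤ 2 * n)
    have h2 : (n : ℝ) ≤ N := by exact_mod_cast (by omega : n ≤ N)
    have h3 : (1 : ℝ) ≤ N := by exact_mod_cast hN
    refine ⟨by linarith, by linarith, by linarith, by linarith⟩
  set u : ℕ → ℝ := fun n => w / n ^ β with hu
  have hub : ∀ n ∈ Ico (m + 1) (N + 1), u (n + 1) - u n ≤ -(c0 * F) := by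
    intro n hn
    obtain ⟨b1, b2, b3, b4⟩ := bnd n hn
    have h := (inv_pow_sub_inv_pow_mem β b4).1
    have h2 : c0 * (1 / N ^ (β + 1)) ≤ β / ((n : ℝ) + 1) ^ (β + 1) := by
      calc c0 * (1 / N ^ (β + 1)) = β / (2 * N : ℝ) ^ (β + 1) := by
            rw [hc0, mul_pow]; field_simp
        _ ≤ _ := by gcongr
    have h3 := mul_le_mul_of_nonneg_left (h2.trans h) hw.le
    have e : w * (c0 * (1 / N ^ (β + 1))) = c0 * F := by rw [hF]; ring
    simp only [hu, div_eq_mul_inv]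
    push_cast
    linarith
  have hlb : ∀ n ∈ Ico (m + 1) (N + 1), -(c1 * F) ≤ u (n + 1) - u n := by
    intro n hn
    obtain ⟨b1, b2, b3, b4⟩ := bnd n hn
    have h := (inv_pow_sub_inv_pow_mem β b4).2
    have h2 : β / (n : ℝ) ^ (β + 1) ≤ c1 * (1 / N ^ (β + 1)) := by
      calc β / (n : ℝ) ^ (β + 1) ≤ β / (N / 2 : ℝ) ^ (β + 1) := by gcongr
        _ = _ := by rw [hc1, div_pow]; field_simp
    have h3 := mul_le_mul_of_nonneg_left (h.trans h2) hw.le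
    have e : w * (c1 * (1 / N ^ (β + 1))) = c1 * F := by rw [hF]; ring
    simp only [hu, div_eq_mul_inv]
    push_cast
    linarith
  have hsec : ∀ n, m + 1 ≤ n → n + 1 < N + 1 →
      u (n + 1) - u n + c2 * (F / N) ≤ u (n + 2) - u (n + 1) := by
    intro n hn1 hn2
    obtain ⟨b1, b2, b3, b4⟩ := bnd n (mem_Ico.2 ⟨hn1, by omega⟩)
    have h := le_second_difference_inv_pow β b4
    have h2 : c2 * (1 / N ^ (β + 2)) ≤ β * (β + 1) / ((n : ℝ) + 2) ^ (β + 2) := by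
      calc c2 * (1 / N ^ (β + 2)) = β * (β + 1) / (3 * N : ℝ) ^ (β + 2) := by
            rw [hc2, mul_pow]; field_simp
        _ ≤ _ := by gcongr
    have h3 := mul_le_mul_of_nonneg_left (h2.trans h) hw.le
    have e : w * (c2 * (1 / N ^ (β + 2))) = c2 * (F / N) := by rw [hF]; field_simp; ring
    simp only [hu, div_eq_mul_inv] at *
    push_cast
    linarith
  have q1 : 0 ≤ 1 / c0 := by positivity
  have q2 : 0 ≤ 25 * c1 / √c2 := by positivity
  have q3 : 0 ≤ √c2 := by positivity
  have q4 : 0 ≤ √(F * N) := by positivity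
  have q5 : 0 < 1 / F := by positivity
  rcases le_or_gt (c1 * F) (1 / 2) with hcase | hcase
  · have hkl := norm_sum_expCircle_le_of_increments u (m + 1) (N + 1) (-1) (θ := c0 * F)
      (by positivity)
      (fun n h1 h2 => by
        have := hsec n h1 h2
        have : 0 < c2 * (F / N) := by positivity
        linarith)
      (fun n hn => by
        have := hlb n hn
        have : c0 * F ≤ c1 * F := by gcongr
        push_cast; linarith)
      (fun n hn => by have := hub n hn; push_cast; linarith)
    refine hkl.trans ?_
    calc 1 / (c0 * F) = 1 / c0 * (1 / F) := by field_simp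
      _ ≤ (1 / c0 + 25 * c1 / √c2 + √c2) * (√(F * N) + 1 / F) := by
        apply mul_le_mul <;> first | positivity | linarith
  · rcases le_or_gt (c2 * (F / N)) 1 with hl | hl
    · have hlp : 0 < c2 * (F / N) := by positivity
      set l := c2 * (F / N) with hl_def
      have hsl : 0 < √l := Real.sqrt_pos.2 hlp
      have hv := norm_sum_expCircle_le_of_second_difference u (m + 1) (N + 1)
        (A := -(c1 * F)) (B := 0) (l := l) (θ := √l) (by linarith) hlp hsl hlb
        (fun n hn => (hub n hn).trans (by have := mul_pos p0 hFpos; linarith)) hsec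
      refine hv.trans ?_
      have h1 : √l ≤ 1 := Real.sqrt_le_one.2 hl
      have h2 : √l / l = 1 / √l := Real.sqrt_div_self'.trans rfl
      have h3 : 1 ≤ 1 / √l := (one_le_div hsl).2 h1
      have h4 : 1 / √l + 2 * (√l / l + 1) ≤ 5 * (1 / √l) := by rw [h2]; linarith
      have h5 : 0 - -(c1 * F) + 2 ≤ 5 * (c1 * F) := by linarith
      have h6 : F / √l = √(F * N) / √c2 := by
        rw [hl_def, ← Real.sqrt_div' _ p2.le, eq_comm, Real.sqrt_eq_iff_eq_sq (by positivity)
          (by positivity), div_pow, Real.sq_sqrt hlp.le, hl_def]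
        field_simp
      calc _ ≤ (5 * (c1 * F)) * (5 * (1 / √l)) := by gcongr
        _ = 25 * c1 * (F / √l) := by ring
        _ = 25 * c1 / √c2 * √(F * N) := by rw [h6]; ring
        _ ≤ (1 / c0 + 25 * c1 / √c2 + √c2) * (√(F * N) + 1 / F) := by
          apply mul_le_mul <;> first | positivity | linarith
    · have h1 : ‖∑ n ∈ Ico (m + 1) (N + 1), expCircle (w / n ^ β)‖ ≤ N := by
        refine (norm_sum_le _ _).trans ?_
        simp only [norm_expCircle, sum_const, nsmul_eq_mul, mul_one, Nat.card_Ico]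
        exact_mod_cast (by omega)
      refine h1.trans ?_
      have h2 : (N : ℝ) ≤ √c2 * √(F * N) := by
        rw [← Real.sqrt_mul p2.le]
        apply Real.le_sqrt_of_sq_le
        rw [← mul_div_assoc, lt_div_iff₀ hN'] at hl
        nlinarith
      refine h2.trans ?_
      apply mul_le_mul <;> first | positivity | linarith

/-- The sawtooth function `{t} - 1/2`. -/
noncomputable def sawtooth (t : ℝ) : ℝ := Int.fract t - 1 / 2

/-- The normalised primitive `({t}² - {t}) / 2` of the sawtooth function. -/
noncomputable def sawtoothPrimitive (t : ℝ) : ℝ := (Int.fract t ^ 2 - Int.fract t) / 2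

lemma abs_sawtooth_le (t : ℝ) : |sawtooth t| ≤ 1 / 2 := by
  have h1 := Int.fract_nonneg t
  have h2 := (Int.fract_lt_one t).le
  unfold sawtooth
  rw [abs_le]
  constructor <;> linarith

lemma fract_add_eq_or {t η : ℝ} (h0 : 0 ≤ η) (h1 : η ≤ 1) :
    (Int.fract (t + η) = Int.fract t + η ∧ Int.fract t + η < 1) ∨
      (Int.fract (t + η) = Int.fract t + η - 1 ∧ 1 ≤ Int.fract t + η) := by
  have a1 := Int.fract_nonneg t
  have a2 := Int.fract_lt_one t
  have a3 := Int.floor_add_fract t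
  rcases lt_or_ge (Int.fract t + η) 1 with h | h
  · left
    refine ⟨?_, h⟩
    rw [Int.fract_eq_iff]
    exact ⟨by linarith, h, ⌊t⌋, by linarith⟩
  · right
    refine ⟨?_, h⟩
    rw [Int.fract_eq_iff]
    exact ⟨by linarith, by linarith, ⌊t⌋ + 1, by push_cast; linarith⟩

lemma sawtoothPrimitive_sub_le {t η : ℝ} (h0 : 0 ≤ η) (h1 : η ≤ 1) :
    sawtoothPrimitive (t + η) - sawtoothPrimitive t ≤ η * sawtooth t + η ^ 2 / 2 := by
  unfold sawtoothPrimitive sawtooth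
  have a2 := Int.fract_lt_one t
  rcases fract_add_eq_or (t := t) h0 h1 with ⟨h, h'⟩ | ⟨h, h'⟩ <;> rw [h] <;> nlinarith

lemma le_sawtoothPrimitive_sub {t η : ℝ} (h0 : 0 ≤ η) (h1 : η ≤ 1) :
    η * sawtooth (t + η) - η ^ 2 / 2 ≤ sawtoothPrimitive (t + η) - sawtoothPrimitive t := by
  unfold sawtoothPrimitive sawtooth
  have a2 := Int.fract_lt_one t
  rcases fract_add_eq_or (t := t) h0 h1 with ⟨h, h'⟩ | ⟨h, h'⟩ <;> rw [h] <;> nlinarith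

lemma hasSum_cos_div_sq (t : ℝ) :
    HasSum (fun n : ℕ => 1 / (n : ℝ) ^ 2 * Real.cos (2 * Real.pi * (n * t)))
      (Real.pi ^ 2 * (2 * sawtoothPrimitive t + 1 / 6)) := by
  have h := hasSum_one_div_nat_pow_mul_cos one_ne_zero
    (x := Int.fract t) ⟨Int.fract_nonneg t, (Int.fract_lt_one t).le⟩
  have e : Polynomial.bernoulli 2 = Polynomial.X ^ 2 - Polynomial.X + Polynomial.C (1 / 6) := by
    rw [Polynomial.bernoulli_def]
    have hC : (Polynomial.C (-1 / 2 : ℚ)) * 2 = -1 := by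
      rw [show (2 : Polynomial ℚ) = Polynomial.C 2 from rfl, ← Polynomial.C_mul]
      norm_num
    simp [Finset.sum_range_succ, bernoulli_two, bernoulli_one,
      Polynomial.C_mul_X_pow_eq_monomial.symm]
    linear_combination Polynomial.X * hC
  convert! h using 1
  · funext n
    have : 2 * Real.pi * (n * t) = 2 * Real.pi * n * Int.fract t + (n * ⌊t⌋ : ℤ) * (2 * Real.pi) := by
      push_cast
      rw [Int.fract]; ring
    rw [this, Real.cos_add_int_mul_two_pi, mul_one]
  · rw [mul_one, e]
    simp [sawtoothPrimitive, Nat.factorial]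
    ring

lemma sum_min_mul_sqrt_div_sq_le {η : ℝ} (hη : 0 < η) (n : ℕ) :
    ∑ h ∈ range (n + 1), min 1 ((h : ℝ) * η) * (√h / (h : ℝ) ^ 2) ≤
      8 * √η * (√(n * η) / (1 + √(n * η))) := by
  induction n with
  | zero => simp
  | succ n ih =>
    rw [Finset.sum_range_succ]
    set s := √(n * η) with hs
    set t := √((n + 1 : ℕ) * η) with ht
    have hs0 : 0 ≤ s := Real.sqrt_nonneg _
    have ht0 : 0 < t := Real.sqrt_pos.2 (by positivity)
    have hs2 : s ^ 2 = n * η := Real.sq_sqrt (by positivity)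
    have ht2 : t ^ 2 = (n + 1 : ℕ) * η := Real.sq_sqrt (by positivity)
    have hst : t ^ 2 - s ^ 2 = η := by rw [hs2, ht2]; push_cast; ring
    have hle : s ≤ t := Real.sqrt_le_sqrt (by push_cast; nlinarith)
    have hη' : 0 < √η := Real.sqrt_pos.2 hη
    have hη2 : √η ^ 2 = η := Real.sq_sqrt hη.le
    set p := √η with hp
    have hn : ((n + 1 : ℕ) : ℝ) = (t / p) ^ 2 := by
      rw [div_pow, hη2, ht2]; field_simp
    have hterm : min 1 (((n + 1 : ℕ) : ℝ) * η) * (√((n + 1 : ℕ) : ℝ) / ((n + 1 : ℕ) : ℝ) ^ 2) =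
        min 1 (t ^ 2) * (p ^ 3 / t ^ 3) := by
      rw [← ht2, hn, Real.sqrt_sq (by positivity)]
      field_simp
    rw [hterm]
    have hmin : min 1 (t ^ 2) * (1 + t) ^ 2 ≤ 4 * t ^ 2 := by
      rcases le_total t 1 with h | h
      · calc min 1 (t ^ 2) * (1 + t) ^ 2 ≤ t ^ 2 * (1 + t) ^ 2 := by gcongr; exact min_le_right _ _
          _ ≤ t ^ 2 * (1 + 1) ^ 2 := by gcongr
          _ = _ := by ring
      · calc min 1 (t ^ 2) * (1 + t) ^ 2 ≤ 1 * (1 + t) ^ 2 := by gcongr; exact min_le_left _ _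
          _ ≤ 1 * (t + t) ^ 2 := by gcongr
          _ = _ := by ring
    have h1 : min 1 (t ^ 2) * (p ^ 3 / t ^ 3) ≤ 4 * p ^ 3 / (t * (1 + t) ^ 2) := by
      rw [le_div_iff₀ (by positivity)]
      calc _ = (min 1 (t ^ 2) * (1 + t) ^ 2) * (p ^ 3 / t ^ 2) := by field_simp
        _ ≤ 4 * t ^ 2 * (p ^ 3 / t ^ 2) := by gcongr
        _ = _ := by field_simp
    have h2 : p ^ 2 / (2 * t * (1 + t) ^ 2) ≤ t / (1 + t) - s / (1 + s) := by
      have : t / (1 + t) - s / (1 + s) = (t - s) / ((1 + t) * (1 + s)) := by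
        field_simp; ring
      rw [this, div_le_div_iff₀ (by positivity) (by positivity), hη2, ← hst]
      have h3 : (t ^ 2 - s ^ 2) ≤ (t - s) * (2 * t) := by nlinarith
      have h4 : (1 + t) * (1 + s) ≤ (1 + t) ^ 2 := by nlinarith
      calc (t ^ 2 - s ^ 2) * ((1 + t) * (1 + s)) ≤ ((t - s) * (2 * t)) * (1 + t) ^ 2 := by
            apply mul_le_mul h3 h4 (by positivity)
            exact mul_nonneg (by linarith) (by positivity)
        _ = _ := by ring
    have h5 : 8 * p * (p ^ 2 / (2 * t * (1 + t) ^ 2)) = 4 * p ^ 3 / (t * (1 + t) ^ 2) := by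
      field_simp; ring
    have h6 := mul_le_mul_of_nonneg_left h2 (by positivity : 0 ≤ 8 * p)
    rw [h5] at h6
    linarith

lemma norm_expCircle_sub_one_le {t : ℝ} (ht : 0 ≤ t) :
    ‖expCircle t - 1‖ ≤ 2 * Real.pi * min 1 t := by
  rw [mul_min_of_nonneg _ _ (by positivity), le_min_iff]
  constructor
  · refine (norm_sub_le _ _).trans ?_
    rw [norm_expCircle, norm_one]
    linarith [Real.pi_gt_three]
  · have := Real.norm_exp_I_mul_ofReal_sub_one_le (x := 2 * Real.pi * t)
    rw [Real.norm_of_nonneg (by positivity), mul_comm Complex.I] at this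
    exact this

lemma abs_sum_sawtoothPrimitive_sub_le (s : Finset ℕ) (f : ℕ → ℝ) {η G W : ℝ} (hη : 0 < η)
    (hG : 0 ≤ G) (hW : 0 ≤ W)
    (hS : ∀ h : ℕ, 0 < h → ‖∑ d ∈ s, expCircle (h * f d)‖ ≤ G * √h + W / h) :
    |∑ d ∈ s, (sawtoothPrimitive (f d + η) - sawtoothPrimitive (f d))| ≤
      8 * G * √η + 2 * W * η := by
  have hsum := hasSum_sum (s := s) (fun d _ =>
    (hasSum_cos_div_sq (f d + η)).sub (hasSum_cos_div_sq (f d)))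
  have hterm : ∀ h : ℕ, |∑ d ∈ s, (1 / (h : ℝ) ^ 2 * Real.cos (2 * Real.pi * (h * (f d + η))) -
      1 / (h : ℝ) ^ 2 * Real.cos (2 * Real.pi * (h * f d)))| ≤
      2 * Real.pi * (G * (min 1 ((h : ℝ) * η) * (√h / (h : ℝ) ^ 2)) +
        W * η * ((h : ℝ) ^ 2)⁻¹) := by
    intro h
    rcases Nat.eq_zero_or_pos h with rfl | hpos
    · simp
    have hh : (0 : ℝ) < h := by exact_mod_cast hpos
    have e : ∑ d ∈ s, (1 / (h : ℝ) ^ 2 * Real.cos (2 * Real.pi * (h * (f d + η))) -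
      1 / (h : ℝ) ^ 2 * Real.cos (2 * Real.pi * (h * f d))) =
      1 / (h : ℝ) ^ 2 * ((expCircle (h * η) - 1) * ∑ d ∈ s, expCircle (h * f d)).re := by
      rw [Finset.mul_sum, Complex.re_sum, Finset.mul_sum]
      refine Finset.sum_congr rfl fun d _ => ?_
      rw [sub_mul, one_mul, ← expCircle_add, Complex.sub_re, expCircle_re, expCircle_re]
      ring_nf
    rw [e, abs_mul, abs_of_pos (by positivity)]
    have h1 := (Complex.abs_re_le_norm ((expCircle (h * η) - 1) * ∑ d ∈ s, expCircle (h * f d)))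
    rw [norm_mul] at h1
    have h2 := norm_expCircle_sub_one_le (t := h * η) (by positivity)
    have hm : 0 ≤ min 1 ((h : ℝ) * η) := le_min zero_le_one (by positivity)
    calc 1 / (h : ℝ) ^ 2 * |((expCircle (h * η) - 1) * ∑ d ∈ s, expCircle (h * f d)).re|
        ≤ 1 / (h : ℝ) ^ 2 * ((2 * Real.pi * min 1 (h * η)) * (G * √h + W / h)) := by
          gcongr
          exact h1.trans (mul_le_mul h2 (hS h hpos) (norm_nonneg _) (by positivity))
      _ = 2 * Real.pi * (G * (min 1 ((h : ℝ) * η) * (√h / (h : ℝ) ^ 2)) +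
          W * min 1 (h * η) / h * ((h : ℝ) ^ 2)⁻¹) := by field_simp
      _ ≤ 2 * Real.pi * (G * (min 1 ((h : ℝ) * η) * (√h / (h : ℝ) ^ 2)) +
          W * (h * η) / h * ((h : ℝ) ^ 2)⁻¹) := by
          gcongr
          exact min_le_right _ _
      _ = _ := by field_simp
  have hpart : ∀ n : ℕ, |∑ h ∈ range n, ∑ d ∈ s,
      (1 / (h : ℝ) ^ 2 * Real.cos (2 * Real.pi * (h * (f d + η))) -
      1 / (h : ℝ) ^ 2 * Real.cos (2 * Real.pi * (h * f d)))| ≤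
      2 * Real.pi * (G * (8 * √η) + W * η * 2) := by
    intro n
    refine (Finset.abs_sum_le_sum_abs _ _).trans ((Finset.sum_le_sum fun h _ => hterm h).trans ?_)
    rw [← Finset.mul_sum, Finset.sum_add_distrib, ← Finset.mul_sum, ← Finset.mul_sum]
    have b1 : ∑ h ∈ range n, min 1 ((h : ℝ) * η) * (√h / (h : ℝ) ^ 2) ≤ 8 * √η := by
      have h1 : ∑ h ∈ range n, min 1 ((h : ℝ) * η) * (√h / (h : ℝ) ^ 2) ≤
          ∑ h ∈ range (n + 1), min 1 ((h : ℝ) * η) * (√h / (h : ℝ) ^ 2) := by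
        rw [Finset.sum_range_succ]
        have : 0 ≤ min 1 ((n : ℝ) * η) * (√n / (n : ℝ) ^ 2) :=
          mul_nonneg (le_min zero_le_one (by positivity)) (by positivity)
        linarith
      refine h1.trans ((sum_min_mul_sqrt_div_sq_le hη n).trans ?_)
      apply mul_le_of_le_one_right (by positivity)
      rw [div_le_one (by positivity)]
      linarith
    have b2 : ∑ h ∈ range n, ((h : ℝ) ^ 2)⁻¹ ≤ 2 := by
      have h1 := sum_Ioo_inv_sq_le (α := ℝ) 0 n
      have h2 : ∑ h ∈ range n, ((h : ℝ) ^ 2)⁻¹ = ∑ h ∈ Ioo 0 n, ((h : ℝ) ^ 2)⁻¹ := by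
        symm
        apply Finset.sum_subset
        · intro h hh; rw [mem_Ioo] at hh; exact mem_range.2 hh.2
        · intro h h3 h4
          have : h = 0 := by
            by_contra h5
            exact h4 (mem_Ioo.2 ⟨Nat.pos_of_ne_zero h5, mem_range.1 h3⟩)
          simp [this]
      rw [h2]
      refine h1.trans (by norm_num)
    gcongr
  have hlim := le_of_tendsto' (hsum.tendsto_sum_nat.abs) hpart
  have e2 : ∑ d ∈ s, (Real.pi ^ 2 * (2 * sawtoothPrimitive (f d + η) + 1 / 6) -
      Real.pi ^ 2 * (2 * sawtoothPrimitive (f d) + 1 / 6)) =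
      2 * Real.pi ^ 2 * ∑ d ∈ s, (sawtoothPrimitive (f d + η) - sawtoothPrimitive (f d)) := by
    rw [Finset.mul_sum]
    exact Finset.sum_congr rfl fun d _ => by ring
  rw [e2, abs_mul, abs_of_pos (by positivity)] at hlim
  have hpi := Real.pi_gt_three
  have e3 : 2 * Real.pi * (G * (8 * √η) + W * η * 2) ≤
      2 * Real.pi ^ 2 * (8 * G * √η + 2 * W * η) := by
    have : 0 ≤ 8 * G * √η + 2 * W * η := by positivity
    nlinarith [mul_nonneg this (by positivity : 0 ≤ Real.pi)]
  exact le_of_mul_le_mul_left (hlim.trans e3) (by positivity)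

/-- Sums of the sawtooth function are controlled by exponential sums. -/
theorem abs_sum_sawtooth_le (s : Finset ℕ) (f : ℕ → ℝ) {η G W : ℝ} (hη : 0 < η) (hη1 : η ≤ 1)
    (hG : 0 ≤ G) (hW : 0 ≤ W)
    (hS : ∀ h : ℕ, 0 < h → ‖∑ d ∈ s, expCircle (h * f d)‖ ≤ G * √h + W / h) :
    |∑ d ∈ s, sawtooth (f d)| ≤ s.card * η + 8 * G / √η + 2 * W := by
  have h1 := abs_sum_sawtoothPrimitive_sub_le s f hη hG hW hS
  have h2 := abs_sum_sawtoothPrimitive_sub_le s (fun d => f d - η) hη hG hW (by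
    intro h hh
    have e : ∑ d ∈ s, expCircle (h * (f d - η)) =
        (∑ d ∈ s, expCircle (h * f d)) * expCircle (-(h * η)) := by
      rw [Finset.sum_mul]
      refine Finset.sum_congr rfl fun d _ => ?_
      rw [← expCircle_add]; ring_nf
    rw [e, norm_mul, norm_expCircle, mul_one]
    exact hS h hh)
  have h3 : ∑ d ∈ s, (sawtoothPrimitive (f d + η) - sawtoothPrimitive (f d)) ≤
      ∑ d ∈ s, (η * sawtooth (f d) + η ^ 2 / 2) :=
    Finset.sum_le_sum fun d _ => sawtoothPrimitive_sub_le hη.le hη1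
  have h4 : ∑ d ∈ s, (η * sawtooth (f d) - η ^ 2 / 2) ≤
      ∑ d ∈ s, (sawtoothPrimitive (f d - η + η) - sawtoothPrimitive (f d - η)) :=
    Finset.sum_le_sum fun d _ => by
      have := le_sawtoothPrimitive_sub (t := f d - η) hη.le hη1
      rwa [sub_add_cancel] at this ⊢
  rw [Finset.sum_add_distrib, ← Finset.mul_sum, Finset.sum_const, nsmul_eq_mul] at h3
  rw [Finset.sum_sub_distrib, ← Finset.mul_sum, Finset.sum_const, nsmul_eq_mul] at h4
  have h5 := abs_le.1 h1
  have h6 := abs_le.1 h2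
  have hc : (0 : ℝ) ≤ s.card * η ^ 2 := by positivity
  have hsq : √η * √η = η := Real.mul_self_sqrt hη.le
  have hsp : 0 < √η := Real.sqrt_pos.2 hη
  have e : η * (s.card * η + 8 * G / √η + 2 * W) = s.card * η ^ 2 + (8 * G * √η + 2 * W * η) := by
    have : η / √η = √η := by rw [div_eq_iff hsp.ne', hsq]
    calc _ = s.card * η ^ 2 + (8 * G * (η / √η) + 2 * W * η) := by ring
      _ = _ := by rw [this]
  refine le_of_mul_le_mul_left ?_ hη
  rw [e, ← abs_of_pos hη, ← abs_mul, abs_of_pos hη, abs_le]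
  constructor <;> linarith

theorem exists_abs_sum_sawtooth_div_pow_le (β : ℕ) (hβ : 0 < β) :
    ∃ C > 0, ∀ (m N : ℕ) (y F : ℝ), N ≤ 2 * m + 1 → 0 < N → 0 < y → F = y / N ^ (β + 1) →
      |∑ n ∈ Ico (m + 1) (N + 1), sawtooth (y / n ^ β)| ≤
        C * ((N : ℝ) ^ (2 / 3 : ℝ) * F ^ (1 / 3 : ℝ) + 1 / F) := by
  obtain ⟨C, hC, hexp⟩ := exists_norm_sum_expCircle_div_pow_le β hβ
  refine ⟨1 + 8 * C, by positivity, ?_⟩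
  intro m N y F hmN hN hy hF
  have hN' : (0 : ℝ) < N := by exact_mod_cast hN
  have hFpos : 0 < F := by rw [hF]; positivity
  set a := (N : ℝ) ^ (1 / 3 : ℝ) with ha
  set b := F ^ (1 / 3 : ℝ) with hb
  have ha0 : 0 < a := by positivity
  have hb0 : 0 < b := by positivity
  have ha3 : (N : ℝ) = a ^ 3 := by rw [ha, ← Real.rpow_mul_natCast hN'.le]; norm_num
  have hb3 : F = b ^ 3 := by rw [hb, ← Real.rpow_mul_natCast hFpos.le]; norm_num
  have ha2 : (N : ℝ) ^ (2 / 3 : ℝ) = a ^ 2 := by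
    rw [ha, ← Real.rpow_mul_natCast hN'.le]; norm_num
  rw [ha2]
  have hcard : ((Ico (m + 1) (N + 1)).card : ℝ) ≤ N := by
    rw [Nat.card_Ico]; exact_mod_cast (by omega)
  rcases le_or_gt F N with hFN | hFN
  · have hba : b ≤ a := Real.rpow_le_rpow hFpos.le hFN (by norm_num)
    have h := abs_sum_sawtooth_le (Ico (m + 1) (N + 1)) (fun n => y / (n : ℝ) ^ β)
      (η := b / a) (G := C * √(F * N)) (W := C / F) (by positivity)
      ((div_le_one ha0).2 hba) (by positivity) (by positivity) (by
        intro k hk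
        have hk' : (0 : ℝ) < k := by exact_mod_cast hk
        have h1 := hexp m N (k * y) (k * F) hmN hN (by positivity) (by rw [hF]; ring)
        have e : √(k * F * N) = √(F * N) * √k := by
          rw [← Real.sqrt_mul (by positivity)]; ring_nf
        rw [e] at h1
        simp only [← mul_div_assoc]
        refine h1.trans (le_of_eq ?_)
        field_simp)
    have e1 : √(F * N) / √(b / a) = a ^ 2 * b := by
      rw [← Real.sqrt_div' _ (by positivity), hb3, ha3,
        show b ^ 3 * a ^ 3 / (b / a) = (a ^ 2 * b) ^ 2 by field_simp,
        Real.sqrt_sq (by positivity)]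
    have e2 : (N : ℝ) * (b / a) = a ^ 2 * b := by rw [ha3]; field_simp
    refine h.trans ?_
    calc _ ≤ (N : ℝ) * (b / a) + 8 * (C * √(F * N)) / √(b / a) + 2 * (C / F) := by gcongr
      _ = (1 + 8 * C) * (a ^ 2 * b) + (2 * C) * (1 / F) := by
        rw [mul_div_assoc, mul_div_assoc, e1, e2]; ring
      _ ≤ (1 + 8 * C) * (a ^ 2 * b) + (1 + 8 * C) * (1 / F) := by gcongr; linarith
      _ = _ := by ring
  · have hab : a ≤ b := Real.rpow_le_rpow hN'.le hFN.le (by norm_num)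
    have h1 : |∑ n ∈ Ico (m + 1) (N + 1), sawtooth (y / n ^ β)| ≤ N := by
      refine (Finset.abs_sum_le_sum_abs _ _).trans
        ((Finset.sum_le_sum fun n _ => (abs_sawtooth_le _).trans
          (by norm_num : (1 / 2 : ℝ) ≤ 1)).trans ?_)
      rw [sum_const, nsmul_eq_mul, mul_one]
      exact hcard
    refine h1.trans ?_
    have h2 : (N : ℝ) ≤ a ^ 2 * b := by
      rw [ha3]
      calc a ^ 3 = a ^ 2 * a := by ring
        _ ≤ _ := by gcongr
    have h3 : 0 < 1 / F := by positivity
    calc (N : ℝ) ≤ 1 * (a ^ 2 * b + 1 / F) := by linarith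
      _ ≤ _ := by gcongr; linarith

/-- Abel summation against a nonnegative monotone weight. -/
lemma abs_sum_mul_le_of_monotone {w a : ℕ → ℝ} (hw : Monotone w) (hw0 : ∀ n, 0 ≤ w n) {B : ℝ}
    {m N : ℕ} (hmN : m ≤ N) (hB : ∀ k, m ≤ k → |∑ n ∈ Ico k N, a n| ≤ B) :
    |∑ n ∈ Ico m N, w n * a n| ≤ w N * B := by
  have key : ∀ k, m ≤ k → k ≤ N →
      |∑ n ∈ Ico k N, w n * a n - w k * ∑ n ∈ Ico k N, a n| ≤ (w N - w k) * B := by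
    intro k hk hkN
    induction hkN using Nat.decreasingInduction with
    | self => simp
    | of_succ k hkN ih =>
      have ih := ih (by omega)
      rw [Finset.sum_eq_sum_Ico_succ_bot hkN, Finset.sum_eq_sum_Ico_succ_bot hkN]
      have h1 := hB (k + 1) (by omega)
      have h2 : 0 ≤ w (k + 1) - w k := by linarith [hw (Nat.le_succ k)]
      have e : w k * a k + ∑ n ∈ Ico (k + 1) N, w n * a n -
          w k * (a k + ∑ n ∈ Ico (k + 1) N, a n) =
          (∑ n ∈ Ico (k + 1) N, w n * a n - w (k + 1) * ∑ n ∈ Ico (k + 1) N, a n) +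
          (w (k + 1) - w k) * ∑ n ∈ Ico (k + 1) N, a n := by ring
      rw [e]
      refine (abs_add_le _ _).trans ?_
      rw [abs_mul, abs_of_nonneg h2]
      have := mul_le_mul_of_nonneg_left h1 h2
      linarith
  have h1 := key m le_rfl hmN
  have h2 := mul_le_mul_of_nonneg_left (hB m le_rfl) (hw0 m)
  have h3 := abs_add_le (∑ n ∈ Ico m N, w n * a n - w m * ∑ n ∈ Ico m N, a n)
    (w m * ∑ n ∈ Ico m N, a n)
  rw [sub_add_cancel, abs_mul (w m), abs_of_nonneg (hw0 m)] at h3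
  linarith

theorem exists_abs_sum_pow_mul_sawtooth_block_le (β : ℕ) (hβ : 0 < β) :
    ∃ C > 0, ∀ (m N : ℕ) (y : ℝ), m ≤ N → N ≤ 2 * m + 1 → 0 < N → 0 < y →
      |∑ n ∈ Ico (m + 1) (N + 1), (n : ℝ) ^ β * sawtooth (y / n ^ β)| ≤
        C * ((N : ℝ) ^ ((1 + 2 * (β : ℝ)) / 3) * y ^ (1 / 3 : ℝ) + (N : ℝ) ^ (1 + 2 * β) / y) := by
  obtain ⟨C, hC, hS⟩ := exists_abs_sum_sawtooth_div_pow_le β hβ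
  refine ⟨2 ^ β * C, by positivity, ?_⟩
  intro m N y hmN' hmN hN hy
  have hN' : (0 : ℝ) < N := by exact_mod_cast hN
  have h := abs_sum_mul_le_of_monotone (w := fun n : ℕ => (n : ℝ) ^ β)
    (a := fun n : ℕ => sawtooth (y / n ^ β)) (m := m + 1) (N := N + 1)
    (fun i j hij => by simp only; gcongr) (fun n => by positivity) (by omega)
    (fun k hk => by
      obtain ⟨k, rfl⟩ : ∃ j, k = j + 1 := ⟨k - 1, by omega⟩
      exact hS k N y _ (by omega) hN hy rfl)
  refine h.trans ?_
  have h1 : ((N + 1 : ℕ) : ℝ) ^ β ≤ 2 ^ β * (N : ℝ) ^ β := by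
    rw [← mul_pow]
    have : (1 : ℝ) ≤ N := by exact_mod_cast hN
    push_cast
    gcongr
    linarith
  have e1 : (N : ℝ) ^ β * ((N : ℝ) ^ (2 / 3 : ℝ) * (y / (N : ℝ) ^ (β + 1)) ^ (1 / 3 : ℝ)) =
      (N : ℝ) ^ ((1 + 2 * (β : ℝ)) / 3) * y ^ (1 / 3 : ℝ) := by
    rw [Real.div_rpow hy.le (by positivity), ← Real.rpow_natCast, ← Real.rpow_natCast,
      ← Real.rpow_mul hN'.le, div_eq_mul_inv (y ^ (1 / 3 : ℝ)), ← Real.rpow_neg hN'.le]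
    rw [show ∀ p q r s : ℝ, p * (q * (r * s)) = (p * q * s) * r by intros; ring,
      ← Real.rpow_add hN', ← Real.rpow_add hN']
    congr 2
    push_cast
    ring
  have e2 : (N : ℝ) ^ β * (1 / (y / (N : ℝ) ^ (β + 1))) = (N : ℝ) ^ (1 + 2 * β) / y := by
    field_simp
    ring
  calc _ ≤ (2 ^ β * (N : ℝ) ^ β) *
        (C * ((N : ℝ) ^ (2 / 3 : ℝ) * (y / N ^ (β + 1)) ^ (1 / 3 : ℝ) +
          1 / (y / (N : ℝ) ^ (β + 1)))) := by gcongr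
    _ = 2 ^ β * C * ((N : ℝ) ^ β * ((N : ℝ) ^ (2 / 3 : ℝ) * (y / (N : ℝ) ^ (β + 1)) ^ (1 / 3 : ℝ)) +
        (N : ℝ) ^ β * (1 / (y / (N : ℝ) ^ (β + 1)))) := by ring
    _ = _ := by rw [e1, e2]

theorem exists_abs_sum_pow_mul_sawtooth_le (β : ℕ) (hβ : 0 < β) :
    ∃ C > 0, ∀ (N : ℕ) (y : ℝ), 0 < y →
      |∑ n ∈ Ico 1 (N + 1), (n : ℝ) ^ β * sawtooth (y / n ^ β)| ≤
        C * ((N : ℝ) ^ ((1 + 2 * (β : ℝ)) / 3) * y ^ (1 / 3 : ℝ) + (N : ℝ) ^ (1 + 2 * β) / y) := by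
  obtain ⟨C, hC, hS⟩ := exists_abs_sum_pow_mul_sawtooth_block_le β hβ
  refine ⟨2 * C, by positivity, ?_⟩
  intro N y hy
  have hβ1 : (1 : ℝ) ≤ β := by exact_mod_cast hβ
  induction N using Nat.strong_induction_on with
  | _ N ih =>
    rcases Nat.eq_zero_or_pos N with rfl | hN
    · simp; positivity
    have ih := ih (N / 2) (by omega)
    have hb := hS (N / 2) N y (by omega) (by omega) hN hy
    rw [← Finset.sum_Ico_consecutive _ (by omega : 1 ≤ N / 2 + 1) (by omega : N / 2 + 1 ≤ N + 1)]
    have hhalf : ((N / 2 : ℕ) : ℝ) ≤ N / 2 := Nat.cast_div_le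
    have h1 : ((N / 2 : ℕ) : ℝ) ^ ((1 + 2 * (β : ℝ)) / 3) ≤
        (N : ℝ) ^ ((1 + 2 * (β : ℝ)) / 3) / 2 := by
      calc _ ≤ ((N : ℝ) / 2) ^ ((1 + 2 * (β : ℝ)) / 3) := by gcongr
        _ = (N : ℝ) ^ ((1 + 2 * (β : ℝ)) / 3) / 2 ^ ((1 + 2 * (β : ℝ)) / 3) :=
          Real.div_rpow (by positivity) (by norm_num) _
        _ ≤ _ := by
          gcongr
          exact Real.self_le_rpow_of_one_le (by norm_num) (by linarith)
    have h2 : ((N / 2 : ℕ) : ℝ) ^ (1 + 2 * β) ≤ (N : ℝ) ^ (1 + 2 * β) / 2 := by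
      calc _ ≤ ((N : ℝ) / 2) ^ (1 + 2 * β) := by gcongr
        _ = (N : ℝ) ^ (1 + 2 * β) / 2 ^ (1 + 2 * β) := by rw [div_pow]
        _ ≤ _ := by
          gcongr
          exact le_self_pow₀ (by norm_num) (by omega)
    have h3 : 2 * C * (((N / 2 : ℕ) : ℝ) ^ ((1 + 2 * (β : ℝ)) / 3) * y ^ (1 / 3 : ℝ) +
        ((N / 2 : ℕ) : ℝ) ^ (1 + 2 * β) / y) ≤
        2 * C * ((N : ℝ) ^ ((1 + 2 * (β : ℝ)) / 3) / 2 * y ^ (1 / 3 : ℝ) +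
          (N : ℝ) ^ (1 + 2 * β) / 2 / y) := by gcongr
    have h4 : 2 * C * ((N : ℝ) ^ ((1 + 2 * (β : ℝ)) / 3) / 2 * y ^ (1 / 3 : ℝ) +
          (N : ℝ) ^ (1 + 2 * β) / 2 / y) =
        C * ((N : ℝ) ^ ((1 + 2 * (β : ℝ)) / 3) * y ^ (1 / 3 : ℝ) + (N : ℝ) ^ (1 + 2 * β) / y) := by
      ring
    refine (abs_add_le _ _).trans ?_
    linarith

lemma sum_moebius_divisors_of_pow_dvd (β : ℕ) (hβ : 0 < β) {q : ℕ} (hq : 0 < q) (h : ℕ) :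
    ∑ e ∈ q.divisors with e ^ β ∣ h, ArithmeticFunction.moebius e =
      if ∀ d : ℕ, 1 < d → ¬(d ^ β ∣ h ∧ d ^ β ∣ q ^ β) then 1 else 0 := by
  set D := q.divisors.filter (fun e => e ^ β ∣ h) with hD
  have hmem : ∀ e, e ∈ D ↔ e ∣ q ∧ e ^ β ∣ h := fun e => by
    simp [hD, hq.ne']
  have hne : D.Nonempty := ⟨1, (hmem 1).2 ⟨one_dvd _, by simp⟩⟩
  set g := D.max' hne with hg
  have hgD := (hmem g).1 (D.max'_mem hne)
  have hg0 : 0 < g := Nat.pos_of_dvd_of_pos hgD.1 hq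
  have hDg : D = g.divisors := by
    ext e
    rw [hmem, Nat.mem_divisors]
    constructor
    · rintro ⟨h1, h2⟩
      refine ⟨?_, hg0.ne'⟩
      have h3 : e.lcm g ∈ D := (hmem _).2 ⟨Nat.lcm_dvd h1 hgD.1, by
        rw [← Nat.pow_lcm_pow]; exact Nat.lcm_dvd h2 hgD.2⟩
      have h4 : e.lcm g ≤ g := D.le_max' _ h3
      have h5 : e.lcm g = g :=
        le_antisymm h4 (Nat.le_of_dvd (Nat.pos_of_dvd_of_pos ((hmem _).1 h3).1 hq)
          (Nat.dvd_lcm_right e g))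
      rw [← h5]
      exact Nat.dvd_lcm_left e g
    · rintro ⟨h1, -⟩
      exact ⟨h1.trans hgD.1, (pow_dvd_pow_of_dvd h1 β).trans hgD.2⟩
  rw [hDg, ← ArithmeticFunction.coe_mul_zeta_apply, ArithmeticFunction.moebius_mul_coe_zeta,
    ArithmeticFunction.one_apply]
  refine if_congr ⟨fun h1 d hd hd' => ?_, fun h1 => ?_⟩ rfl rfl
  · have h2 : d ∈ D := (hmem d).2 ⟨(Nat.pow_dvd_pow_iff hβ.ne').1 hd'.2, hd'.1⟩
    have := D.le_max' d h2
    omega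
  · by_contra h2
    exact h1 g (by omega) ⟨hgD.2, pow_dvd_pow_of_dvd hgD.1 β⟩

lemma sum_range_exp_eq_ite (m n : ℕ) (hm : 0 < m) :
    ∑ j ∈ range m, Complex.exp (2 * Real.pi * Complex.I * n * j / m) =
      if m ∣ n then (m : ℂ) else 0 := by
  have hζ := Complex.isPrimitiveRoot_exp m hm.ne'
  have hm' : (m : ℂ) ≠ 0 := by exact_mod_cast hm.ne'
  have e : ∀ j : ℕ, Complex.exp (2 * Real.pi * Complex.I * n * j / m) =
      (Complex.exp (2 * Real.pi * Complex.I / m) ^ n) ^ j := fun j => by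
    rw [← Complex.exp_nat_mul, ← Complex.exp_nat_mul]
    ring_nf
  simp_rw [e]
  split_ifs with h
  · rw [(hζ.pow_eq_one_iff_dvd n).2 h]
    simp
  · have h1 : Complex.exp (2 * Real.pi * Complex.I / m) ^ n ≠ 1 := fun h2 =>
      h ((hζ.pow_eq_one_iff_dvd n).1 h2)
    rw [geom_sum_eq h1, ← pow_mul, mul_comm n m, pow_mul, hζ.pow_eq_one]
    simp

lemma sum_filter_dvd_range_mul {M : Type*} [AddCommMonoid M] (a b : ℕ) (ha : 0 < a) (f : ℕ → M) :
    ∑ h ∈ range (a * b) with a ∣ h, f h = ∑ j ∈ range b, f (a * j) := by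
  symm
  apply Finset.sum_bij (fun j _ => a * j)
  · intro j hj
    rw [mem_range] at hj
    exact mem_filter.2 ⟨mem_range.2 (Nat.mul_lt_mul_of_pos_left hj ha), dvd_mul_right _ _⟩
  · intro i _ j _ hij
    exact Nat.eq_of_mul_eq_mul_left ha hij
  · intro h hh
    obtain ⟨h1, j, rfl⟩ := mem_filter.1 hh
    exact ⟨j, mem_range.2 (Nat.lt_of_mul_lt_mul_left (mem_range.1 h1)), rfl⟩
  · intro j _
    rfl

theorem cohenRamanujan_eq (β q n : ℕ) (hβ : 0 < β) (hq : 0 < q) :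
    cohenRamanujan β q n =
      ∑ p ∈ q.divisorsAntidiagonal,
        (ArithmeticFunction.moebius p.1 : ℂ) * (if p.2 ^ β ∣ n then (p.2 : ℂ) ^ β else 0) := by
  unfold cohenRamanujan
  rw [sum_filter]
  have e1 : ∀ h ∈ range (q ^ β),
      (if ∀ d : ℕ, 1 < d → ¬(d ^ β ∣ h ∧ d ^ β ∣ q ^ β) then
        Complex.exp (2 * Real.pi * Complex.I * n * h / (q ^ β)) else 0) =
      ∑ e ∈ q.divisors, if e ^ β ∣ h then (ArithmeticFunction.moebius e : ℂ) *
        Complex.exp (2 * Real.pi * Complex.I * n * h / (q ^ β)) else 0 := by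
    intro h _
    rw [← sum_filter, ← sum_mul, ← Int.cast_sum, sum_moebius_divisors_of_pow_dvd β hβ hq]
    split_ifs <;> simp
  rw [sum_congr rfl e1, sum_comm]
  rw [Nat.sum_divisorsAntidiagonal (f := fun a b =>
    (ArithmeticFunction.moebius a : ℂ) * (if b ^ β ∣ n then (b : ℂ) ^ β else 0))]
  refine sum_congr rfl fun e he => ?_
  obtain ⟨d, rfl⟩ := (Nat.mem_divisors.1 he).1
  have he0 : 0 < e := Nat.pos_of_mul_pos_right hq
  have hd0 : 0 < d := Nat.pos_of_mul_pos_left hq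
  rw [Nat.mul_div_cancel_left _ he0, ← sum_filter, ← mul_sum, mul_pow,
    sum_filter_dvd_range_mul _ _ (by positivity)]
  congr 1
  have h1 := sum_range_exp_eq_ite (d ^ β) n (by positivity)
  push_cast at h1
  rw [← h1]
  refine sum_congr rfl fun j _ => ?_
  congr 1
  have he' : (e : ℂ) ≠ 0 := by exact_mod_cast he0.ne'
  push_cast
  rw [mul_pow]
  field_simp

/-- Evaluation of the first moment as a hyperbola-type sum. -/
theorem momentC_one_eq (β : ℕ) (hβ : 0 < β) (x y : ℝ) :
    momentC 1 β x y =
      ((∑ e ∈ Ioc 0 ⌊x⌋₊, (ArithmeticFunction.moebius e : ℝ) *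
        ∑ d ∈ Ioc 0 (⌊x⌋₊ / e), (d : ℝ) ^ β * ⌊y / (d : ℝ) ^ β⌋₊ : ℝ) : ℂ) := by
  unfold momentC
  simp only [pow_one]
  rw [sum_comm]
  set g : ArithmeticFunction ℂ :=
    ⟨fun d => (d : ℂ) ^ β * (⌊y / (d : ℝ) ^ β⌋₊ : ℂ), by simp [hβ.ne']⟩ with hg
  have h1 : ∀ q ∈ Icc 1 ⌊x⌋₊, ∑ n ∈ Icc 1 ⌊y⌋₊, cohenRamanujan β q n =
      (((ArithmeticFunction.moebius : ArithmeticFunction ℤ) : ArithmeticFunction ℂ) * g) q := by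
    intro q hq
    have hq0 : 0 < q := (mem_Icc.1 hq).1
    simp_rw [cohenRamanujan_eq β q _ hβ hq0]
    rw [sum_comm, ArithmeticFunction.mul_apply]
    refine sum_congr rfl fun p hp => ?_
    rw [← mul_sum, ArithmeticFunction.intCoe_apply]
    congr 1
    rw [← sum_filter, sum_const, nsmul_eq_mul, mul_comm]
    change _ = (p.2 : ℂ) ^ β * (⌊y / (p.2 : ℝ) ^ β⌋₊ : ℂ)
    congr 2
    have h2 := Nat.Ioc_filter_dvd_card_eq_div ⌊y⌋₊ (p.2 ^ β)
    have h3 := Nat.floor_div_natCast y (p.2 ^ β)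
    push_cast at h3
    rw [h3, ← h2]
    congr 1
  rw [sum_congr rfl h1]
  have h4 : Icc 1 ⌊x⌋₊ = Ioc 0 ⌊x⌋₊ := rfl
  rw [h4, ArithmeticFunction.sum_Ioc_mul_eq_sum_sum]
  push_cast
  rfl

lemma pow_mul_floor_div_pow (β d : ℕ) (hd : 0 < d) {y : ℝ} (hy : 0 ≤ y) :
    (d : ℝ) ^ β * ⌊y / (d : ℝ) ^ β⌋₊ =
      y - (d : ℝ) ^ β / 2 - (d : ℝ) ^ β * sawtooth (y / (d : ℝ) ^ β) := by
  have hd' : (0 : ℝ) < (d : ℝ) ^ β := by positivity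
  have h1 : ((⌊y / (d : ℝ) ^ β⌋₊ : ℕ) : ℝ) = (⌊y / (d : ℝ) ^ β⌋ : ℤ) :=
    natCast_floor_eq_intCast_floor (by positivity)
  rw [h1, sawtooth, ← Int.self_sub_floor]
  field_simp
  ring

lemma sum_moebius_mul_div_eq_one {N : ℕ} (hN : 0 < N) :
    ∑ e ∈ Ioc 0 N, (ArithmeticFunction.moebius e : ℝ) * ((N / e : ℕ) : ℝ) = 1 := by
  have h := ArithmeticFunction.sum_Ioc_mul_zeta_eq_sum
    (ArithmeticFunction.moebius : ArithmeticFunction ℤ) N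
  rw [ArithmeticFunction.moebius_mul_coe_zeta] at h
  have h2 : ∑ n ∈ Ioc 0 N, (1 : ArithmeticFunction ℤ) n = 1 := by
    rw [Finset.sum_eq_single_of_mem 1 (by simp; omega)]
    · simp
    · intro b _ hb
      simp [hb]
  rw [h2] at h
  have h3 := congrArg (Int.cast : ℤ → ℝ) h.symm
  simpa only [Int.cast_sum, Int.cast_mul, Int.cast_natCast, Int.cast_one] using h3

lemma pow_succ_sub_pow_succ_le (β : ℕ) {a b : ℝ} (ha : 0 ≤ a) (hab : a ≤ b) :
    b ^ (β + 1) - a ^ (β + 1) ≤ (β + 1) * b ^ β * (b - a) := by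
  induction β with
  | zero => simp
  | succ k ih =>
    have hb : 0 ≤ b := ha.trans hab
    have h1 : a ^ (k + 1) ≤ b ^ (k + 1) := pow_le_pow_left₀ ha hab _
    have h2 := mul_le_mul_of_nonneg_left ih hb
    have h3 := mul_le_mul_of_nonneg_right h1 (sub_nonneg.2 hab)
    push_cast
    have e1 : b ^ (k + 1 + 1) - a ^ (k + 1 + 1) =
      b * (b ^ (k + 1) - a ^ (k + 1)) + a ^ (k + 1) * (b - a) := by ring
    have e2 : ((k : ℝ) + 1 + 1) * b ^ (k + 1) * (b - a) =
      b * ((k + 1) * b ^ k * (b - a)) + b ^ (k + 1) * (b - a) := by ring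
    rw [e1, e2]
    linarith

lemma le_pow_succ_sub_pow_succ (β : ℕ) {a b : ℝ} (ha : 0 ≤ a) (hab : a ≤ b) :
    (β + 1) * a ^ β * (b - a) ≤ b ^ (β + 1) - a ^ (β + 1) := by
  induction β with
  | zero => simp
  | succ k ih =>
    have hb : 0 ≤ b := ha.trans hab
    have h1 : a ^ (k + 1) ≤ b ^ (k + 1) := pow_le_pow_left₀ ha hab _
    have h2 := mul_le_mul_of_nonneg_left ih ha
    have h3 := mul_le_mul_of_nonneg_right h1 (sub_nonneg.2 hab)
    push_cast
    have e1 : b ^ (k + 1 + 1) - a ^ (k + 1 + 1) =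
      a * (b ^ (k + 1) - a ^ (k + 1)) + b ^ (k + 1) * (b - a) := by ring
    have e2 : ((k : ℝ) + 1 + 1) * a ^ (k + 1) * (b - a) =
      a * ((k + 1) * a ^ k * (b - a)) + a ^ (k + 1) * (b - a) := by ring
    rw [e1, e2]
    linarith

lemma pow_succ_div_le_sum_pow (β n : ℕ) :
    (n : ℝ) ^ (β + 1) / (β + 1) ≤ ∑ d ∈ Ioc 0 n, (d : ℝ) ^ β := by
  induction n with
  | zero => simp
  | succ n ih =>
    rw [Finset.sum_Ioc_succ_top (Nat.zero_le n)]
    have h := pow_succ_sub_pow_succ_le β (Nat.cast_nonneg n : (0 : ℝ) ≤ n)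
      (by push_cast; linarith : (n : ℝ) ≤ ((n + 1 : ℕ) : ℝ))
    have hβ : (0 : ℝ) < β + 1 := by positivity
    rw [div_le_iff₀ hβ] at ih ⊢
    push_cast at *
    nlinarith

lemma sum_pow_le_pow_succ_div_add (β n : ℕ) :
    ∑ d ∈ Ioc 0 n, (d : ℝ) ^ β ≤ (n : ℝ) ^ (β + 1) / (β + 1) + (n : ℝ) ^ β := by
  induction n with
  | zero => simp
  | succ n ih =>
    rw [Finset.sum_Ioc_succ_top (Nat.zero_le n)]
    have h := le_pow_succ_sub_pow_succ β (Nat.cast_nonneg n : (0 : ℝ) ≤ n)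
      (by push_cast; linarith : (n : ℝ) ≤ ((n + 1 : ℕ) : ℝ))
    have hβ : (0 : ℝ) < β + 1 := by positivity
    rw [← sub_le_iff_le_add, le_div_iff₀ hβ] at ih
    rw [add_le_add_iff_right, le_div_iff₀ hβ]
    push_cast at *
    nlinarith

lemma abs_sum_pow_sub_le (β n : ℕ) {z : ℝ} (h1 : (n : ℝ) ≤ z) (h2 : z < n + 1) :
    |∑ d ∈ Ioc 0 n, (d : ℝ) ^ β - z ^ (β + 1) / (β + 1)| ≤ z ^ β := by
  have hn : (0 : ℝ) ≤ n := Nat.cast_nonneg n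
  have hz : 0 ≤ z := hn.trans h1
  have hβ : (0 : ℝ) < β + 1 := by positivity
  have h3 := pow_succ_div_le_sum_pow β n
  have h4 := sum_pow_le_pow_succ_div_add β n
  have h5 : (n : ℝ) ^ (β + 1) / (β + 1) ≤ z ^ (β + 1) / (β + 1) := by gcongr
  have h6 : (n : ℝ) ^ β ≤ z ^ β := by gcongr
  have h7 : z ^ (β + 1) / (β + 1) ≤ (n : ℝ) ^ (β + 1) / (β + 1) + z ^ β := by
    have := pow_succ_sub_pow_succ_le β hn h1
    have h8 : ((β : ℝ) + 1) * z ^ β * (z - n) ≤ (β + 1) * z ^ β * 1 :=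
      mul_le_mul_of_nonneg_left (by linarith) (by positivity)
    rw [div_add' _ _ _ hβ.ne', div_le_div_iff_of_pos_right hβ]
    linarith
  rw [abs_le]
  constructor <;> linarith

lemma exists_sum_rpow_neg_le (s : ℝ) (hs : 1 ≤ s) :
    ∃ K > 0, ∀ x : ℝ, 3 ≤ x →
      ∑ e ∈ Ioc 0 ⌊x⌋₊, (e : ℝ) ^ (-s) ≤ K * (if s = 1 then Real.log x else 1) := by
  by_cases h : s = 1
  · subst h
    refine ⟨2, by norm_num, fun x hx => ?_⟩
    rw [if_pos rfl]
    have hl : 1 ≤ Real.log x := by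
      rw [Real.le_log_iff_exp_le (by linarith)]
      exact (Real.exp_one_lt_d9.le.trans (by norm_num)).trans hx
    have h1 := harmonic_floor_le_one_add_log x (by linarith)
    rw [harmonic_eq_sum_Icc] at h1
    push_cast at h1
    have h2 : ∑ e ∈ Ioc 0 ⌊x⌋₊, (e : ℝ) ^ (-1 : ℝ) = ∑ e ∈ Icc 1 ⌊x⌋₊, (e : ℝ)⁻¹ :=
      Finset.sum_congr rfl fun e _ => Real.rpow_neg_one _
    rw [h2]
    linarith
  · have hs' : 1 < s := lt_of_le_of_ne hs (Ne.symm h)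
    have hsum : Summable fun n : ℕ => (n : ℝ) ^ (-s) := Real.summable_nat_rpow.2 (by linarith)
    have hpos : ∀ n : ℕ, 0 ≤ (n : ℝ) ^ (-s) := fun n => by positivity
    refine ⟨(∑' n : ℕ, (n : ℝ) ^ (-s)) + 1, by
      have : 0 ≤ ∑' n : ℕ, (n : ℝ) ^ (-s) := tsum_nonneg hpos
      linarith, fun x _ => ?_⟩
    rw [if_neg h, mul_one]
    have := hsum.sum_le_tsum (Ioc 0 ⌊x⌋₊) (fun i _ => hpos i)
    linarith

lemma abs_moebius_div_pow_le (β : ℕ) (hβ : 0 < β) (e : ℕ) :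
    |(ArithmeticFunction.moebius e : ℝ) / (e : ℝ) ^ (β + 1)| ≤ ((e : ℝ) ^ 2)⁻¹ := by
  rcases Nat.eq_zero_or_pos e with rfl | he
  · simp
  have h1 : |(ArithmeticFunction.moebius e : ℝ)| ≤ 1 := by
    exact_mod_cast ArithmeticFunction.abs_moebius_le_one
  have he' : (1 : ℝ) ≤ e := by exact_mod_cast he
  rw [abs_div, abs_of_nonneg (by positivity : (0 : ℝ) ≤ (e : ℝ) ^ (β + 1)), ← one_div]
  exact div_le_div₀ zero_le_one h1 (by positivity) (pow_le_pow_right₀ he' (by omega))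

lemma summable_moebius_div_pow (β : ℕ) (hβ : 0 < β) :
    Summable fun e : ℕ => (ArithmeticFunction.moebius e : ℝ) / (e : ℝ) ^ (β + 1) :=
  Summable.of_norm_bounded (Real.summable_nat_pow_inv.2 (by norm_num : 1 < 2))
    (abs_moebius_div_pow_le β hβ)

lemma tsum_moebius_div_pow (β : ℕ) (hβ : 0 < β) :
    ((∑' e : ℕ, (ArithmeticFunction.moebius e : ℝ) / (e : ℝ) ^ (β + 1) : ℝ) : ℂ) =
      (riemannZeta (1 + (β : ℂ)))⁻¹ := by
  have hs : 1 < (1 + (β : ℂ)).re := by simpa using hβ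
  have h := ArithmeticFunction.LSeries_zeta_mul_Lseries_moebius hs
  rw [ArithmeticFunction.LSeries_zeta_eq_riemannZeta hs] at h
  rw [← eq_inv_of_mul_eq_one_right h, LSeries, Complex.ofReal_tsum]
  refine tsum_congr fun e => ?_
  rcases Nat.eq_zero_or_pos e with rfl | he
  · simp
  rw [LSeries.term_of_ne_zero he.ne']
  push_cast
  congr 1
  rw [← Complex.cpow_natCast]
  push_cast
  ring_nf

lemma abs_sum_moebius_div_pow_sub_tsum_le (β : ℕ) (hβ : 0 < β) (N : ℕ) :
    |∑ e ∈ Ioc 0 N, (ArithmeticFunction.moebius e : ℝ) / (e : ℝ) ^ (β + 1) -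
      ∑' e : ℕ, (ArithmeticFunction.moebius e : ℝ) / (e : ℝ) ^ (β + 1)| ≤ 2 / (N + 1) := by
  have hs := summable_moebius_div_pow β hβ
  have ht := hs.hasSum.tendsto_sum_nat
  have h2 : Filter.Tendsto (fun n : ℕ => |∑ e ∈ Ioc 0 N,
      (ArithmeticFunction.moebius e : ℝ) / (e : ℝ) ^ (β + 1) -
      ∑ e ∈ range n, (ArithmeticFunction.moebius e : ℝ) / (e : ℝ) ^ (β + 1)|) Filter.atTop
      (nhds _) := (tendsto_const_nhds.sub ht).abs
  refine le_of_tendsto h2 ?_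
  filter_upwards [Filter.eventually_ge_atTop (N + 1)] with n hn
  have h3 : ∑ e ∈ Ioc 0 N, (ArithmeticFunction.moebius e : ℝ) / (e : ℝ) ^ (β + 1) =
      ∑ e ∈ range (N + 1), (ArithmeticFunction.moebius e : ℝ) / (e : ℝ) ^ (β + 1) := by
    rw [Finset.range_eq_Ico, Finset.sum_eq_sum_Ico_succ_bot (Nat.succ_pos N)]
    simp only [Nat.cast_zero, ArithmeticFunction.map_zero, Int.cast_zero, zero_div, zero_add]
    rfl
  rw [h3, abs_sub_comm, ← Finset.sum_Ico_eq_sub _ hn]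
  have h4 : Ico (N + 1) n = Ioo N n := rfl
  rw [h4]
  exact ((Finset.abs_sum_le_sum_abs _ _).trans
    (Finset.sum_le_sum fun e _ => abs_moebius_div_pow_le β hβ e)).trans (sum_Ioo_inv_sq_le N n)

lemma abs_sum_moebius_mul_sum_pow_sub_le (β : ℕ) (hβ : 0 < β) {x : ℝ} (hx : 1 ≤ x) :
    |∑ e ∈ Ioc 0 ⌊x⌋₊, (ArithmeticFunction.moebius e : ℝ) *
        ∑ d ∈ Ioc 0 (⌊x⌋₊ / e), (d : ℝ) ^ β -
      x ^ (β + 1) / (β + 1) *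
        ∑' e : ℕ, (ArithmeticFunction.moebius e : ℝ) / (e : ℝ) ^ (β + 1)| ≤
      x ^ β * ∑ e ∈ Ioc 0 ⌊x⌋₊, (e : ℝ) ^ (-(β : ℝ)) + x ^ β := by
  set M := ∑' e : ℕ, (ArithmeticFunction.moebius e : ℝ) / (e : ℝ) ^ (β + 1) with hM
  have hx0 : 0 < x := by linarith
  have hβ1 : (1 : ℝ) ≤ β := by exact_mod_cast hβ
  have h1 := abs_sum_moebius_div_pow_sub_tsum_le β hβ ⌊x⌋₊
  have h2 : |∑ e ∈ Ioc 0 ⌊x⌋₊, (ArithmeticFunction.moebius e : ℝ) *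
        ∑ d ∈ Ioc 0 (⌊x⌋₊ / e), (d : ℝ) ^ β - x ^ (β + 1) / (β + 1) *
        ∑ e ∈ Ioc 0 ⌊x⌋₊, (ArithmeticFunction.moebius e : ℝ) / (e : ℝ) ^ (β + 1)| ≤
      x ^ β * ∑ e ∈ Ioc 0 ⌊x⌋₊, (e : ℝ) ^ (-(β : ℝ)) := by
    rw [Finset.mul_sum, Finset.mul_sum, ← Finset.sum_sub_distrib]
    refine (Finset.abs_sum_le_sum_abs _ _).trans (Finset.sum_le_sum fun e he => ?_)
    have he0 : 0 < e := (mem_Ioc.1 he).1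
    have he0' : (0 : ℝ) < e := by exact_mod_cast he0
    have h3 : |(ArithmeticFunction.moebius e : ℝ)| ≤ 1 := by
      exact_mod_cast ArithmeticFunction.abs_moebius_le_one
    have h4 : ((⌊x⌋₊ / e : ℕ) : ℝ) ≤ x / e := by
      rw [← Nat.floor_div_natCast]
      exact Nat.floor_le (by positivity)
    have h5 : x / e < ((⌊x⌋₊ / e : ℕ) : ℝ) + 1 := by
      rw [← Nat.floor_div_natCast]
      exact Nat.lt_floor_add_one _
    have h6 := abs_sum_pow_sub_le β _ h4 h5
    have e1 : (ArithmeticFunction.moebius e : ℝ) * ∑ d ∈ Ioc 0 (⌊x⌋₊ / e), (d : ℝ) ^ β -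
        x ^ (β + 1) / (β + 1) * ((ArithmeticFunction.moebius e : ℝ) / (e : ℝ) ^ (β + 1)) =
        (ArithmeticFunction.moebius e : ℝ) *
        (∑ d ∈ Ioc 0 (⌊x⌋₊ / e), (d : ℝ) ^ β - (x / e) ^ (β + 1) / (β + 1)) := by
      rw [div_pow]
      ring
    have e2 : x ^ β * (e : ℝ) ^ (-(β : ℝ)) = (x / e) ^ β := by
      rw [Real.rpow_neg he0'.le, Real.rpow_natCast, div_pow, div_eq_mul_inv]
    rw [e1, e2, abs_mul]
    calc _ ≤ 1 * (x / e) ^ β := by gcongr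
      _ = _ := one_mul _
  have h3 : |x ^ (β + 1) / (β + 1) *
        ∑ e ∈ Ioc 0 ⌊x⌋₊, (ArithmeticFunction.moebius e : ℝ) / (e : ℝ) ^ (β + 1) -
        x ^ (β + 1) / (β + 1) * M| ≤ x ^ β := by
    rw [← mul_sub, abs_mul, abs_of_nonneg (by positivity)]
    have h4 : 2 / ((⌊x⌋₊ : ℝ) + 1) ≤ 2 / x := by
      gcongr
      exact (Nat.lt_floor_add_one x).le
    calc _ ≤ x ^ (β + 1) / (1 + 1) * (2 / x) := by
          gcongr
          exact h1.trans h4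
      _ = x ^ β := by
          rw [pow_succ]
          field_simp
          ring
  have h4 := (abs_sub_le _ _ _).trans (add_le_add h2 h3)
  exact h4

lemma abs_sum_moebius_mul_sum_pow_mul_sawtooth_le {β : ℕ} {C : ℝ}
    (hC : 0 < C) (hG : ∀ (N : ℕ) (y : ℝ), 0 < y →
      |∑ n ∈ Ico 1 (N + 1), (n : ℝ) ^ β * sawtooth (y / n ^ β)| ≤
        C * ((N : ℝ) ^ ((1 + 2 * (β : ℝ)) / 3) * y ^ (1 / 3 : ℝ) + (N : ℝ) ^ (1 + 2 * β) / y))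
    {x y : ℝ} (hx : 1 ≤ x) (hy : 0 < y) :
    |∑ e ∈ Ioc 0 ⌊x⌋₊, (ArithmeticFunction.moebius e : ℝ) *
        ∑ d ∈ Ioc 0 (⌊x⌋₊ / e), (d : ℝ) ^ β * sawtooth (y / (d : ℝ) ^ β)| ≤
      C * (x ^ ((1 + 2 * (β : ℝ)) / 3) * y ^ (1 / 3 : ℝ) *
          ∑ e ∈ Ioc 0 ⌊x⌋₊, (e : ℝ) ^ (-((1 + 2 * (β : ℝ)) / 3)) +
        x ^ (1 + 2 * β) * y⁻¹ * ∑ e ∈ Ioc 0 ⌊x⌋₊, (e : ℝ) ^ (-(1 + 2 * (β : ℝ)))) := by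
  have hx0 : 0 < x := by linarith
  rw [Finset.mul_sum, Finset.mul_sum, ← Finset.sum_add_distrib, Finset.mul_sum]
  refine (Finset.abs_sum_le_sum_abs _ _).trans (Finset.sum_le_sum fun e he => ?_)
  have he0 : 0 < e := (mem_Ioc.1 he).1
  have he0' : (0 : ℝ) < e := by exact_mod_cast he0
  have h3 : |(ArithmeticFunction.moebius e : ℝ)| ≤ 1 := by
    exact_mod_cast ArithmeticFunction.abs_moebius_le_one
  have h4 : ((⌊x⌋₊ / e : ℕ) : ℝ) ≤ x / e := by
    rw [← Nat.floor_div_natCast]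
    exact Nat.floor_le (by positivity)
  have h5 := hG (⌊x⌋₊ / e) y hy
  have e1 : Ico 1 (⌊x⌋₊ / e + 1) = Ioc 0 (⌊x⌋₊ / e) := rfl
  rw [e1] at h5
  have e2 : x ^ ((1 + 2 * (β : ℝ)) / 3) * y ^ (1 / 3 : ℝ) * (e : ℝ) ^ (-((1 + 2 * (β : ℝ)) / 3)) =
      (x / e) ^ ((1 + 2 * (β : ℝ)) / 3) * y ^ (1 / 3 : ℝ) := by
    rw [Real.div_rpow hx0.le he0'.le, Real.rpow_neg he0'.le]
    ring
  have e3 : x ^ (1 + 2 * β) * y⁻¹ * (e : ℝ) ^ (-(1 + 2 * (β : ℝ))) =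
      (x / e) ^ (1 + 2 * β) / y := by
    have : (1 + 2 * (β : ℝ)) = ((1 + 2 * β : ℕ) : ℝ) := by push_cast; ring
    rw [this, Real.rpow_neg he0'.le, Real.rpow_natCast, div_pow]
    ring
  rw [e2, e3, abs_mul]
  calc _ ≤ 1 * (C * (((⌊x⌋₊ / e : ℕ) : ℝ) ^ ((1 + 2 * (β : ℝ)) / 3) * y ^ (1 / 3 : ℝ) +
        ((⌊x⌋₊ / e : ℕ) : ℝ) ^ (1 + 2 * β) / y)) := by gcongr
    _ ≤ _ := by
      rw [one_mul]
      gcongr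

lemma sum_moebius_mul_sum_pow_mul_floor_eq (β : ℕ) {N : ℕ} (hN : 0 < N) {y : ℝ} (hy : 0 ≤ y) :
    ∑ e ∈ Ioc 0 N, (ArithmeticFunction.moebius e : ℝ) *
        ∑ d ∈ Ioc 0 (N / e), (d : ℝ) ^ β * ⌊y / (d : ℝ) ^ β⌋₊ =
      y - (∑ e ∈ Ioc 0 N, (ArithmeticFunction.moebius e : ℝ) *
        ∑ d ∈ Ioc 0 (N / e), (d : ℝ) ^ β) / 2 -
      ∑ e ∈ Ioc 0 N, (ArithmeticFunction.moebius e : ℝ) *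
        ∑ d ∈ Ioc 0 (N / e), (d : ℝ) ^ β * sawtooth (y / (d : ℝ) ^ β) := by
  have h := sum_moebius_mul_div_eq_one hN
  rw [show y = y * ∑ e ∈ Ioc 0 N, (ArithmeticFunction.moebius e : ℝ) * ((N / e : ℕ) : ℝ) by
    rw [h, mul_one], Finset.mul_sum, Finset.sum_div, ← Finset.sum_sub_distrib,
    ← Finset.sum_sub_distrib, ← Finset.mul_sum, h, mul_one]
  refine Finset.sum_congr rfl fun e _ => ?_
  rw [Finset.sum_congr rfl fun d hd => pow_mul_floor_div_pow β d (mem_Ioc.1 hd).1 hy,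
    Finset.sum_sub_distrib, Finset.sum_sub_distrib, Finset.sum_const, Nat.card_Ioc, nsmul_eq_mul,
    ← Finset.sum_div, Nat.sub_zero]
  ring

theorem first_moment_exponent_pairs (β : ℕ) (hβ : 0 < β) :
    ∃ C > 0, ∃ x₀ : ℝ, 3 ≤ x₀ ∧ ∀ x y : ℝ, x₀ ≤ x → (x : ℝ) ^ β ≤ y →
      ‖momentC 1 β x y - (y : ℂ) +
          ((x ^ (1 + β) : ℝ) : ℂ) / (2 * (1 + (β : ℂ)) * riemannZeta (1 + (β : ℂ)))‖ ≤
        C * (if β = 1 then x * y ^ ((1 : ℝ) / 3) * Real.log x + x ^ 3 * y⁻¹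
             else x ^ ((1 + 2 * (β : ℝ)) / 3) * y ^ ((1 : ℝ) / 3) + x ^ (1 + 2 * β) * y⁻¹) := by
  have hβ1 : (1 : ℝ) ≤ β := by exact_mod_cast hβ
  obtain ⟨C, hC, hG⟩ := exists_abs_sum_pow_mul_sawtooth_le β hβ
  obtain ⟨K₁, hK₁, h₁⟩ := exists_sum_rpow_neg_le β hβ1
  obtain ⟨K₂, hK₂, h₂⟩ := exists_sum_rpow_neg_le ((1 + 2 * (β : ℝ)) / 3) (by linarith)
  obtain ⟨K₃, hK₃, h₃⟩ := exists_sum_rpow_neg_le (1 + 2 * (β : ℝ)) (by linarith)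
  refine ⟨K₁ + 1 + C * (K₂ + K₃), by positivity, 3, le_rfl, fun x y hx hxy => ?_⟩
  have hx1 : 1 ≤ x := by linarith
  have hx0 : 0 < x := by linarith
  have hy1 : 1 ≤ y := (one_le_pow₀ hx1).trans hxy
  have hy0 : 0 < y := by linarith
  specialize h₁ x hx
  specialize h₂ x hx
  specialize h₃ x hx
  have hL : (1 : ℝ) ≤ if β = 1 then Real.log x else 1 := by
    split_ifs
    · rw [Real.le_log_iff_exp_le hx0]
      exact (Real.exp_one_lt_d9.le.trans (by norm_num)).trans hx
    · exact le_rfl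
  have c₁ : ((β : ℝ) = 1) = (β = 1) := by simp
  have c₂ : ((1 + 2 * (β : ℝ)) / 3 = 1) = (β = 1) := by
    rw [← c₁, eq_iff_iff]
    constructor <;> intro h <;> linarith
  have c₃ : ¬ (1 + 2 * (β : ℝ) = 1) := by linarith
  simp only [c₁] at h₁
  simp only [c₂] at h₂
  rw [if_neg c₃, mul_one] at h₃
  have hR : (if β = 1 then x * y ^ ((1 : ℝ) / 3) * Real.log x + x ^ 3 * y⁻¹
      else x ^ ((1 + 2 * (β : ℝ)) / 3) * y ^ ((1 : ℝ) / 3) + x ^ (1 + 2 * β) * y⁻¹) =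
      x ^ ((1 + 2 * (β : ℝ)) / 3) * y ^ ((1 : ℝ) / 3) * (if β = 1 then Real.log x else 1) +
        x ^ (1 + 2 * β) * y⁻¹ := by
    split_ifs with h
    · subst h
      norm_num
    · rw [mul_one]
  rw [hR]
  set L := if β = 1 then Real.log x else 1 with hLdef
  set A := x ^ ((1 + 2 * (β : ℝ)) / 3) * y ^ ((1 : ℝ) / 3) with hA
  set B := x ^ (1 + 2 * β) * y⁻¹ with hB
  set M := ∑' e : ℕ, (ArithmeticFunction.moebius e : ℝ) / (e : ℝ) ^ (β + 1) with hM
  have hA0 : 0 ≤ A := by positivity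
  have hB0 : 0 ≤ B := by positivity
  have hxA : x ^ β ≤ A := by
    have h1 : (x ^ β) ^ ((1 : ℝ) / 3) ≤ y ^ ((1 : ℝ) / 3) := by gcongr
    calc x ^ β = x ^ (β : ℝ) := (Real.rpow_natCast x β).symm
      _ ≤ x ^ ((1 + 2 * (β : ℝ)) / 3 + β * (1 / 3)) :=
          Real.rpow_le_rpow_of_exponent_le hx1 (by linarith)
      _ = x ^ ((1 + 2 * (β : ℝ)) / 3) * (x ^ β) ^ ((1 : ℝ) / 3) := by
          rw [Real.rpow_add hx0, Real.rpow_mul hx0.le, Real.rpow_natCast]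
      _ ≤ A := mul_le_mul_of_nonneg_left h1 (by positivity)
  have hX : 0 < ⌊x⌋₊ := Nat.floor_pos.2 hx1
  have hP := abs_sum_moebius_mul_sum_pow_sub_le β hβ hx1
  have hS := abs_sum_moebius_mul_sum_pow_mul_sawtooth_le hC hG hx1 hy0
  rw [← hM] at hP
  rw [momentC_one_eq β hβ, sum_moebius_mul_sum_pow_mul_floor_eq β hX hy0.le]
  set P := ∑ e ∈ Ioc 0 ⌊x⌋₊, (ArithmeticFunction.moebius e : ℝ) *
        ∑ d ∈ Ioc 0 (⌊x⌋₊ / e), (d : ℝ) ^ β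
  set S := ∑ e ∈ Ioc 0 ⌊x⌋₊, (ArithmeticFunction.moebius e : ℝ) *
        ∑ d ∈ Ioc 0 (⌊x⌋₊ / e), (d : ℝ) ^ β * sawtooth (y / (d : ℝ) ^ β)
  have hmain : ((y - P / 2 - S : ℝ) : ℂ) - (y : ℂ) +
      ((x ^ (1 + β) : ℝ) : ℂ) / (2 * (1 + (β : ℂ)) * riemannZeta (1 + (β : ℂ))) =
      ((-(P - x ^ (β + 1) / (β + 1) * M) / 2 - S : ℝ) : ℂ) := by
    have h1 : ((x ^ (1 + β) : ℝ) : ℂ) / (2 * (1 + (β : ℂ)) * riemannZeta (1 + (β : ℂ))) =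
        ((x ^ (1 + β) : ℝ) : ℂ) / (2 * (1 + (β : ℂ))) * (M : ℂ) := by
      rw [hM, tsum_moebius_div_pow β hβ, ← div_div, div_eq_mul_inv _ (riemannZeta _)]
    rw [h1]
    push_cast
    rw [add_comm 1 β, add_comm 1 (β : ℂ), mul_comm 2, ← div_div]
    ring
  rw [hmain, Complex.norm_real, Real.norm_eq_abs]
  have hP' : |P - x ^ (β + 1) / (β + 1) * M| ≤ (K₁ + 1) * (A * L) := by
    refine hP.trans ?_
    have h5 : x ^ β * 1 ≤ A * L := mul_le_mul hxA hL zero_le_one hA0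
    have h6 : x ^ β * ∑ e ∈ Ioc 0 ⌊x⌋₊, (e : ℝ) ^ (-(β : ℝ)) ≤ A * (K₁ * L) :=
      mul_le_mul hxA h₁ (by positivity) hA0
    linarith
  have hS' : |S| ≤ C * (K₂ * (A * L) + K₃ * B) := by
    refine hS.trans (mul_le_mul_of_nonneg_left ?_ hC.le)
    have h5 := mul_le_mul_of_nonneg_left h₂ hA0
    have h6 := mul_le_mul_of_nonneg_left h₃ hB0
    linarith
  have hAL : 0 ≤ A * L := mul_nonneg hA0 (by linarith)
  have h7 : |-(P - x ^ (β + 1) / (β + 1) * M) / 2 - S| ≤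
      |P - x ^ (β + 1) / (β + 1) * M| / 2 + |S| := by
    refine (abs_sub _ _).trans ?_
    rw [abs_div, abs_neg, abs_two]
  refine h7.trans ?_
  have h8 : 0 ≤ (K₁ + 1) * (A * L) := by positivity
  have h9 : 0 ≤ (K₁ + 1) * B := by positivity
  have h10 : 0 ≤ C * K₂ * B := by positivity
  have h11 : 0 ≤ C * K₃ * (A * L) := by positivity
  linarith
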